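/- Let k ≥ 0 and m > n/2 − 1 be integers. Suppose that for every holomorphic F on T_Λ with sup_{z ∈ T_Λ} Δ(Im z)^m |□^m F(z)| < ∞ there exists a holomorphic F̃ on T_Λ with □^m F̃ = □^m F and sup_{z ∈ T_Λ} Δ(Im z)^k |□^k F̃(z)| < ∞. Then necessarily k > (n/2 − 1)/2. -/

import Mathlib

open MeasureTheory Complex Set
open scoped ENNReal

noncomputable section

/-- The Lorentz form `Δ(y) = y₁² − y₂² − ⋯ − yₙ²` on `ℝⁿ`
(written as `2 y₀² − ∑ yᵢ²` with 0-based indexing). -/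
def lor {n : ℕ} [NeZero n] (y : Fin n → ℝ) : ℝ := 2 * y 0 ^ 2 - ∑ i, y i ^ 2

/-- The holomorphic extension of the Lorentz form to `ℂⁿ`. -/
def lorC {n : ℕ} [NeZero n] (z : Fin n → ℂ) : ℂ := 2 * z 0 ^ 2 - ∑ i, z i ^ 2

/-- Componentwise imaginary part. -/
def imP {n : ℕ} (z : Fin n → ℂ) : Fin n → ℝ := fun i => (z i).im

/-- The forward light cone `Λ`. -/
def cone (n : ℕ) [NeZero n] : Set (Fin n → ℝ) := {y | 0 < lor y ∧ 0 < y 0}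

/-- The tube domain `T_Λ` over the forward light cone. -/
def tube (n : ℕ) [NeZero n] : Set (Fin n → ℂ) := {z | imP z ∈ cone n}

/-- The weighted measure `dV_ν = Δ(Im z)^{ν − n/2} dz` on `T_Λ`. -/
def dV (n : ℕ) [NeZero n] (ν : ℝ) : Measure (Fin n → ℂ) :=
  ((volume : Measure (Fin n → ℂ)).restrict (tube n)).withDensity
    (fun z => ENNReal.ofReal (lor (imP z) ^ (ν - (n : ℝ) / 2)))

/-- `∫ |F|^p dV_ν` (as an extended nonnegative real). -/
def lpInt (n : ℕ) [NeZero n] (p ν : ℝ) (F : (Fin n → ℂ) → ℂ) : ℝ≥0∞ :=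
  ∫⁻ z, ENNReal.ofReal (‖F z‖ ^ p) ∂(dV n ν)

/-- The `L^p_ν` norm `(∫ |F|^p dV_ν)^{1/p}`. -/
def lpNorm (n : ℕ) [NeZero n] (p ν : ℝ) (F : (Fin n → ℂ) → ℂ) : ℝ≥0∞ :=
  (lpInt n p ν F) ^ (1 / p)

/-- The Bergman space `A^p_ν`: holomorphic on `T_Λ` and in `L^p_ν`. -/
def memA (n : ℕ) [NeZero n] (p ν : ℝ) (F : (Fin n → ℂ) → ℂ) : Prop :=
  DifferentiableOn ℂ F (tube n) ∧ lpInt n p ν F < ⊤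

/-- Partial derivative `∂/∂zᵢ`. -/
def pd {n : ℕ} (i : Fin n) (F : (Fin n → ℂ) → ℂ) : (Fin n → ℂ) → ℂ :=
  fun z => fderiv ℂ F z (Pi.single i 1)

/-- The wave (Box) operator `□ = −(∂₁² − ∂₂² − ⋯ − ∂ₙ²)`, so that
`□ e^{i z·ξ} = Δ(ξ) e^{i z·ξ}`. -/
def BoxOp {n : ℕ} [NeZero n] (F : (Fin n → ℂ) → ℂ) : (Fin n → ℂ) → ℂ :=
  fun z => -(2 * pd 0 (pd 0 F) z - ∑ i, pd i (pd i F) z)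

/-- The (unnormalized) Bergman kernel `B_β(z,w) = Δ((z − w̄)/i)^{−(β+n)}`. -/
def berg (n : ℕ) [NeZero n] (β : ℝ) (z w : Fin n → ℂ) : ℂ :=
  lorC (fun i => (z i - (starRingEnd ℂ) (w i)) / Complex.I) ^ (-(β + (n : ℝ)) : ℂ)

/-- The Hardy inequality holds for `(p, ν)`:
`∫ |F|^p dV_ν ≤ C ∫ |Δ(Im z) □F(z)|^p dV_ν(z)` for all `F ∈ A^p_ν`. -/
def hardy (n : ℕ) [NeZero n] (p ν : ℝ) : Prop :=
  ∃ C > (0 : ℝ), ∀ F, memA n p ν F →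
    lpInt n p ν F ≤ ENNReal.ofReal C *
      lpInt n p ν (fun z => (lor (imP z) : ℂ) * BoxOp F z)

/-- `g` is the orthogonal projection of `f ∈ L²_ν` onto the closed subspace `A²_ν`:
`g ∈ A²_ν` and `f − g ⊥ A²_ν`. -/
def isProj (n : ℕ) [NeZero n] (ν : ℝ) (f g : (Fin n → ℂ) → ℂ) : Prop :=
  memA n 2 ν g ∧ ∀ h, memA n 2 ν h →
    ∫ z, f z * (starRingEnd ℂ) (h z) ∂(dV n ν) =
      ∫ z, g z * (starRingEnd ℂ) (h z) ∂(dV n ν)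

/-- The Bergman projection `P_ν` admits a bounded extension to `L^p_ν`:
`‖P_ν f‖_{L^p_ν} ≤ C ‖f‖_{L^p_ν}` for all `f ∈ L²_ν ∩ L^p_ν`. -/
def projBounded (n : ℕ) [NeZero n] (p ν : ℝ) : Prop :=
  ∃ C > (0 : ℝ), ∀ f g : (Fin n → ℂ) → ℂ,
    AEStronglyMeasurable f (dV n ν) → lpInt n 2 ν f < ⊤ → lpInt n p ν f < ⊤ →
    isProj n ν f g → lpNorm n p ν g ≤ ENNReal.ofReal C * lpNorm n p ν f

/-- A bounded (continuous) linear functional on `A^p_ν`. -/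
def isBddFunc (n : ℕ) [NeZero n] (p ν : ℝ) (γ : ((Fin n → ℂ) → ℂ) → ℂ) : Prop :=
  (∀ F G, memA n p ν F → memA n p ν G → γ (F + G) = γ F + γ G) ∧
  (∀ (c : ℂ) (F), memA n p ν F → γ (fun z => c * F z) = c * γ F) ∧
  ∃ C : ℝ, ∀ F, memA n p ν F → ‖γ F‖ ≤ C * (lpNorm n p ν F).toReal

section

/-- The directional derivatives of a holomorphic function of several variables are holomorphic. -/
theorem differentiableOn_fderiv_apply {E : Type*} [NormedAddCommGroup E] [NormedSpace ℂ E]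
    [FiniteDimensional ℂ E] {U : Set E} (hU : IsOpen U)
    {K : E → ℂ} (hK : DifferentiableOn ℂ K U) (v : E) :
    DifferentiableOn ℂ (fun z => fderiv ℂ K z v) U := by
  borelize E
  intro z₀ hz₀
  apply DifferentiableAt.differentiableWithinAt
  have hcont : ContinuousAt K z₀ := (hK.differentiableAt (hU.mem_nhds hz₀)).continuousAt
  obtain ⟨ρ, hρ, hball⟩ : ∃ ρ > 0, Metric.ball z₀ (4 * ρ) ⊆ U ∩ K ⁻¹' Metric.ball (K z₀) 1 := by
    obtain ⟨δ, hδ, h⟩ := Metric.mem_nhds_iff.1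
      (Filter.inter_mem (hU.mem_nhds hz₀) (hcont.preimage_mem_nhds (Metric.ball_mem_nhds _ one_pos)))
    exact ⟨δ / 4, by positivity, by convert h using 2; ring⟩
  have hsub : ∀ z ∈ Metric.ball z₀ (2 * ρ), Metric.ball z (2 * ρ) ⊆ Metric.ball z₀ (4 * ρ) := by
    intro z hz
    apply Metric.ball_subset_ball'
    rw [Metric.mem_ball] at hz
    linarith
  have hdiff : ∀ z ∈ Metric.ball z₀ (4 * ρ), DifferentiableAt ℂ K z := fun z hz =>
    hK.differentiableAt (hU.mem_nhds (hball hz).1)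
  have hmem : ∀ z ∈ Metric.ball z₀ (2 * ρ), z ∈ Metric.ball z₀ (4 * ρ) := fun z hz =>
    hsub z hz (Metric.mem_ball_self (by positivity))
  have hbound : ∀ z ∈ Metric.ball z₀ (2 * ρ), ‖fderiv ℂ K z‖ ≤ 2 / (2 * ρ) := by
    intro z hz
    apply Complex.norm_fderiv_le_div_of_mapsTo_ball
    · exact fun w hw => (hdiff w (hsub z hz hw)).differentiableWithinAt
    · intro w hw
      have h1 := (hball (hsub z hz hw)).2
      have h2 := (hball (hmem z hz)).2
      rw [mem_preimage, Metric.mem_ball] at h1 h2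
      rw [Metric.mem_closedBall]
      have := dist_triangle_right (K w) (K z) (K z₀)
      linarith
    · positivity
  obtain ⟨r, hr, hrv⟩ : ∃ r > 0, r * ‖v‖ < ρ := by
    refine ⟨ρ / (1 + ‖v‖), by positivity, ?_⟩
    rw [div_mul_eq_mul_div, div_lt_iff₀ (by positivity)]
    nlinarith [norm_nonneg v]
  have hshift : ∀ z ∈ Metric.ball z₀ ρ, ∀ t : ℂ, ‖t‖ ≤ r → z + t • v ∈ Metric.ball z₀ (2 * ρ) := by
    intro z hz t ht
    rw [Metric.mem_ball, dist_eq_norm] at *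
    calc ‖z + t • v - z₀‖ = ‖(z - z₀) + t • v‖ := by congr 1; abel
      _ ≤ ‖z - z₀‖ + ‖t‖ * ‖v‖ := by rw [← norm_smul]; exact norm_add_le _ _
      _ < 2 * ρ := by nlinarith [mul_le_mul_of_nonneg_right ht (norm_nonneg v)]
  have hcirc : ∀ θ, ‖circleMap 0 r θ‖ ≤ r := fun θ => by simp [abs_of_pos hr]
  let w : ℝ → ℂ := fun θ => deriv (circleMap 0 r) θ * (1 / (circleMap 0 r θ - 0) ^ 2)
  have hw : Continuous w := by
    have h1 : ∀ θ, (circleMap 0 r θ - 0) ^ 2 ≠ 0 := fun θ => by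
      simp [hr.ne']
    simp only [w, deriv_circleMap]
    have := continuous_circleMap 0 r
    exact (this.mul continuous_const).mul (continuous_const.div (by fun_prop) h1)
  have hformula : ∀ z ∈ Metric.ball z₀ ρ,
      fderiv ℂ K z v = (2 * Real.pi * I)⁻¹ * ∫ θ in (0 : ℝ)..2 * Real.pi,
        w θ * K (z + circleMap 0 r θ • v) := by
    intro z hz
    have hd : ∀ t ∈ Metric.closedBall (0 : ℂ) r,
        DifferentiableAt ℂ (fun t : ℂ => K (z + t • v)) t := by
      intro t ht
      have : DifferentiableAt ℂ K (z + t • v) :=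
        hdiff _ (hmem _ (hshift z hz t (by simpa using ht)))
      exact this.comp t (by fun_prop)
    have h := DifferentiableOn.deriv_eq_smul_circleIntegral hr
      (fun t ht => (hd t ht).differentiableWithinAt)
    have hderiv : deriv (fun t : ℂ => K (z + t • v)) 0 = fderiv ℂ K z v := by
      have hz' : DifferentiableAt ℂ K (z + (0 : ℂ) • v) :=
        hdiff _ (hmem _ (hshift z hz 0 (by simpa using hr.le)))
      have h2 : HasDerivAt (fun t : ℂ => z + t • v) v 0 := by
        simpa using ((hasDerivAt_id (0 : ℂ)).smul_const v).const_add z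
      have := (hz'.hasFDerivAt.comp_hasDerivAt (0 : ℂ) h2).deriv
      simpa [Function.comp_def] using this
    rw [hderiv] at h
    have h3 : (∫ θ in (0 : ℝ)..2 * Real.pi, w θ * K (z + circleMap 0 r θ • v)) =
        (2 * Real.pi * I) * fderiv ℂ K z v := by
      rw [← smul_eq_mul (2 * Real.pi * I), ← h, circleIntegral]
      simp only [w, smul_eq_mul, mul_assoc]
    rw [h3, ← mul_assoc, inv_mul_cancel₀ (by simp [Real.pi_ne_zero]), one_mul]
  have hmap : ∀ z ∈ Metric.ball z₀ ρ, ContinuousOn (fun θ => K (z + circleMap 0 r θ • v)) univ := by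
    intro z hz θ _
    have : ContinuousAt K (z + circleMap 0 r θ • v) :=
      (hdiff _ (hmem _ (hshift z hz _ (hcirc θ)))).continuousAt
    exact (this.comp (f := fun θ : ℝ => z + circleMap 0 r θ • v)
      (by have := continuous_circleMap 0 r; fun_prop)).continuousWithinAt
  have hmap' : ∀ z ∈ Metric.ball z₀ ρ, Continuous (fun θ => w θ * K (z + circleMap 0 r θ • v)) :=
    fun z hz => hw.mul (continuousOn_univ.1 (hmap z hz))
  have hder : HasFDerivAt (fun z => ∫ θ in (0 : ℝ)..2 * Real.pi, w θ * K (z + circleMap 0 r θ • v))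
      (∫ θ in (0 : ℝ)..2 * Real.pi, w θ • fderiv ℂ K (z₀ + circleMap 0 r θ • v)) z₀ := by
    refine intervalIntegral.hasFDerivAt_integral_of_dominated_of_fderiv_le
      (F' := fun z θ => w θ • fderiv ℂ K (z + circleMap 0 r θ • v))
      (bound := fun θ => ‖w θ‖ * (2 / (2 * ρ))) (Metric.ball_mem_nhds z₀ hρ) ?_ ?_ ?_ ?_ ?_ ?_
    · filter_upwards [Metric.ball_mem_nhds z₀ hρ] with z hz
      exact (hmap' z hz).aestronglyMeasurable
    · exact (hmap' z₀ (Metric.mem_ball_self hρ)).intervalIntegrable _ _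
    · apply AEStronglyMeasurable.smul hw.aestronglyMeasurable
      apply Measurable.aestronglyMeasurable
      exact (measurable_fderiv ℂ K).comp
        (by have := continuous_circleMap 0 r; fun_prop : Continuous fun θ : ℝ =>
          z₀ + circleMap 0 r θ • v).measurable
    · refine Filter.Eventually.of_forall fun θ _ z hz => ?_
      rw [norm_smul]
      exact mul_le_mul_of_nonneg_left (hbound _ (hshift z hz _ (hcirc θ))) (norm_nonneg _)
    · exact (hw.norm.mul continuous_const).intervalIntegrable _ _
    · refine Filter.Eventually.of_forall fun θ _ z hz => ?_
      have h1 := (hdiff _ (hmem _ (hshift z hz _ (hcirc θ)))).hasFDerivAt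
      have h2 : HasFDerivAt (fun z => z + circleMap 0 r θ • v) (ContinuousLinearMap.id ℂ E) z :=
        (hasFDerivAt_id z).add_const _
      exact (h1.comp z h2).const_mul (w θ)
  refine DifferentiableAt.congr_of_eventuallyEq (hder.differentiableAt.const_mul (2 * Real.pi * I)⁻¹) ?_
  filter_upwards [Metric.ball_mem_nhds z₀ hρ] with z hz using hformula z hz

variable {n : ℕ}

theorem DifferentiableOn.pd {U : Set (Fin n → ℂ)} (hU : IsOpen U) {F : (Fin n → ℂ) → ℂ}
    (hF : DifferentiableOn ℂ F U) (i : Fin n) : DifferentiableOn ℂ (pd i F) U :=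
  differentiableOn_fderiv_apply hU hF _

theorem DifferentiableOn.boxOp [NeZero n] {U : Set (Fin n → ℂ)} (hU : IsOpen U)
    {F : (Fin n → ℂ) → ℂ} (hF : DifferentiableOn ℂ F U) : DifferentiableOn ℂ (BoxOp F) U := by
  have h : ∀ i, DifferentiableOn ℂ (_root_.pd i (_root_.pd i F)) U := fun i => (hF.pd hU i).pd hU i
  exact (((h 0).const_mul 2).sub (DifferentiableOn.fun_sum fun i _ => h i)).neg

theorem DifferentiableOn.iterate_boxOp [NeZero n] {U : Set (Fin n → ℂ)} (hU : IsOpen U)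
    {F : (Fin n → ℂ) → ℂ} (hF : DifferentiableOn ℂ F U) (N : ℕ) :
    DifferentiableOn ℂ (BoxOp^[N] F) U := by
  induction N with
  | zero => exact hF
  | succ N ih => rw [Function.iterate_succ_apply']; exact ih.boxOp hU

theorem eqOn_pd {U : Set (Fin n → ℂ)} (hU : IsOpen U) {F G : (Fin n → ℂ) → ℂ}
    (h : EqOn F G U) (i : Fin n) : EqOn (pd i F) (pd i G) U := fun z hz => by
  have : F =ᶠ[nhds z] G := Filter.eventuallyEq_of_mem (hU.mem_nhds hz) h
  simp only [pd, this.fderiv_eq]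

theorem eqOn_boxOp [NeZero n] {U : Set (Fin n → ℂ)} (hU : IsOpen U) {F G : (Fin n → ℂ) → ℂ}
    (h : EqOn F G U) : EqOn (BoxOp F) (BoxOp G) U := fun z hz => by
  have h2 : ∀ i, pd i (pd i F) z = pd i (pd i G) z := fun i => eqOn_pd hU (eqOn_pd hU h i) i hz
  simp only [BoxOp, h2]

theorem isOpen_cone [NeZero n] : IsOpen (cone n) := by
  have h : Continuous (lor : (Fin n → ℝ) → ℝ) := by unfold lor; fun_prop
  exact (isOpen_lt continuous_const h).inter (isOpen_lt continuous_const (continuous_apply 0))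

theorem isOpen_tube [NeZero n] : IsOpen (tube n) :=
  isOpen_cone.preimage (by unfold imP; fun_prop)

end

section

theorem norm_planeWave {m : ℕ} (ξ : Fin m → ℝ) (z : Fin m → ℂ) :
    ‖cexp (I * ∑ i, (ξ i : ℂ) * z i)‖ = Real.exp (-∑ i, imP z i * ξ i) := by
  rw [Complex.norm_exp]
  simp [imP, mul_comm]

variable {n : ℕ} [NeZero n]

theorem lor_eq_sq_sub_sum_erase (y : Fin n → ℝ) :
    lor y = y 0 ^ 2 - ∑ i ∈ Finset.univ.erase 0, y i ^ 2 := by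
  rw [lor, ← Finset.add_sum_erase _ _ (Finset.mem_univ (0 : Fin n))]
  ring

theorem lor_smul (t : ℝ) (y : Fin n → ℝ) : lor (t • y) = t ^ 2 * lor y := by
  simp only [lor, Pi.smul_apply, smul_eq_mul, mul_pow, mul_sub, Finset.mul_sum]
  ring

theorem smul_mem_cone {y : Fin n → ℝ} (hy : y ∈ cone n) {t : ℝ} (ht : 0 < t) :
    t • y ∈ cone n := by
  refine ⟨?_, mul_pos ht hy.2⟩
  rw [lor_smul]
  exact mul_pos (by positivity) hy.1

/-- The light cone is self-dual; quantitative form. -/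
theorem exists_mul_abs_le_dot {y : Fin n → ℝ} (hy : y ∈ cone n) :
    ∃ δ > 0, ∀ ξ ∈ cone n, ∀ i, δ * |ξ i| ≤ ∑ j, y j * ξ j := by
  set S := (Finset.univ : Finset (Fin n)).erase 0
  have hsqrt : ∀ x ∈ cone n, √(∑ i ∈ S, x i ^ 2) < x 0 := by
    intro x hx
    rw [Real.sqrt_lt' hx.2]
    have := hx.1
    rw [lor_eq_sq_sub_sum_erase] at this
    linarith
  refine ⟨y 0 - √(∑ i ∈ S, y i ^ 2), sub_pos.2 (hsqrt y hy), fun ξ hξ i => ?_⟩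
  have hξi : |ξ i| ≤ ξ 0 := by
    by_cases hi : i = 0
    · rw [hi, abs_of_pos hξ.2]
    · refine le_trans ?_ (hsqrt ξ hξ).le
      apply Real.abs_le_sqrt
      exact Finset.single_le_sum (f := fun i => ξ i ^ 2) (fun _ _ => sq_nonneg _)
        (Finset.mem_erase.2 ⟨hi, Finset.mem_univ i⟩)
  have hcs := Real.sum_mul_le_sqrt_mul_sqrt S (fun i => -y i) ξ
  simp only [neg_sq, neg_mul, Finset.sum_neg_distrib] at hcs
  rw [← Finset.add_sum_erase _ _ (Finset.mem_univ (0 : Fin n))]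
  have h1 := hsqrt ξ hξ
  have h2 := hsqrt y hy
  have h3 : √(∑ i ∈ S, y i ^ 2) * √(∑ i ∈ S, ξ i ^ 2) ≤ √(∑ i ∈ S, y i ^ 2) * ξ 0 :=
    mul_le_mul_of_nonneg_left h1.le (Real.sqrt_nonneg _)
  have h4 := mul_le_mul_of_nonneg_left hξi (sub_pos.2 h2).le
  linarith

variable {ι : Type*}

/-- The superposition of plane waves `z ↦ ∑ⱼ cⱼ exp (i z · ξⱼ)`. -/
def planeWaveSum (ξ : ι → Fin n → ℝ) (c : ι → ℂ) (z : Fin n → ℂ) : ℂ :=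
  ∑' j, c j * cexp (I * ∑ i, (ξ j i : ℂ) * z i)

/-- The plane waves `cⱼ exp (i z · ξⱼ)` are absolutely summable on the tube over the cone. -/
def AbsSummableOnTube (ξ : ι → Fin n → ℝ) (c : ι → ℂ) : Prop :=
  ∀ y ∈ cone n, Summable fun j => ‖c j‖ * Real.exp (-∑ i, y i * ξ j i)

variable {ξ : ι → Fin n → ℝ} {c : ι → ℂ}

theorem AbsSummableOnTube.mul_coord (hξ : ∀ j, ξ j ∈ cone n) (hc : AbsSummableOnTube ξ c)
    (i : Fin n) : AbsSummableOnTube ξ (fun j => c j * (I * ξ j i)) := by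
  intro y hy
  obtain ⟨δ, hδ, h⟩ := exists_mul_abs_le_dot hy
  refine Summable.of_nonneg_of_le (fun j => by positivity) (fun j => ?_)
    ((hc ((1 / 2 : ℝ) • y) (smul_mem_cone hy (by norm_num))).mul_left (2 / δ))
  have h1 := h (ξ j) (hξ j) i
  have h2 : ∑ i, ((1 / 2 : ℝ) • y) i * ξ j i = (∑ i, y i * ξ j i) / 2 := by
    rw [Finset.sum_div]
    exact Finset.sum_congr rfl fun i _ => by simp; ring
  rw [h2]
  set t := ∑ i, y i * ξ j i
  have h3 : |ξ j i| * Real.exp (-t) ≤ 2 / δ * Real.exp (-(t / 2)) := by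
    have h4 : Real.exp (-t) = Real.exp (-(t / 2)) * Real.exp (-(t / 2)) := by
      rw [← Real.exp_add]; congr 1; ring
    have h5 : t / 2 * Real.exp (-(t / 2)) ≤ 1 := by
      rw [Real.exp_neg, ← div_eq_mul_inv, div_le_one (Real.exp_pos _)]
      linarith [Real.add_one_le_exp (t / 2)]
    have h6 : |ξ j i| ≤ t / δ := by rw [le_div_iff₀ hδ]; linarith
    have h7 := Real.exp_pos (-(t / 2))
    calc |ξ j i| * Real.exp (-t) ≤ t / δ * Real.exp (-t) := by gcongr
      _ = 2 / δ * (t / 2 * Real.exp (-(t / 2))) * Real.exp (-(t / 2)) := by rw [h4]; ring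
      _ ≤ 2 / δ * 1 * Real.exp (-(t / 2)) := by gcongr
      _ = _ := by ring
  have h8 : ‖c j * (I * ξ j i)‖ = ‖c j‖ * |ξ j i| := by simp
  rw [h8, mul_assoc, mul_left_comm (2 / δ)]
  exact mul_le_mul_of_nonneg_left h3 (norm_nonneg (c j))

/-- Termwise differentiation of a plane wave superposition. -/
theorem AbsSummableOnTube.differentiableAt_and_pd (hξ : ∀ j, ξ j ∈ cone n)
    (hc : AbsSummableOnTube ξ c) {z₀ : Fin n → ℂ} (hz₀ : z₀ ∈ tube n) :
    DifferentiableAt ℂ (planeWaveSum ξ c) z₀ ∧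
      ∀ i, pd i (planeWaveSum ξ c) z₀ = planeWaveSum ξ (fun j => c j * (I * ξ j i)) z₀ := by
  obtain ⟨δ, hδ, hdot⟩ := exists_mul_abs_le_dot hz₀
  have hn : (0 : ℝ) < n := Nat.cast_pos.2 (NeZero.pos n)
  set r : ℝ := δ / (2 * n)
  have hr : 0 < r := by positivity
  have hhalf := smul_mem_cone hz₀ (show (0 : ℝ) < 1 / 2 by norm_num)
  have himp : ∀ z ∈ Metric.ball z₀ r, ∀ j,
      ∑ i, ((1 / 2 : ℝ) • imP z₀) i * ξ j i ≤ ∑ i, imP z i * ξ j i := by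
    intro z hz j
    have h1 : ∀ i, imP z₀ i * ξ j i - r * (δ⁻¹ * ∑ i, imP z₀ i * ξ j i) ≤ imP z i * ξ j i := by
      intro i
      have h2 : |imP z₀ i - imP z i| ≤ r := by
        have h3 : ‖(z₀ - z) i‖ ≤ ‖z₀ - z‖ := norm_le_pi_norm _ i
        have h4 : ‖z₀ - z‖ < r := by rwa [Metric.mem_ball, dist_comm, dist_eq_norm] at hz
        have h5 := Complex.abs_im_le_norm ((z₀ - z) i)
        simp only [imP, Pi.sub_apply, sub_im] at *
        linarith
      have h6 : |ξ j i| ≤ δ⁻¹ * ∑ i, imP z₀ i * ξ j i := by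
        rw [inv_mul_eq_div, le_div_iff₀ hδ, mul_comm]
        exact hdot _ (hξ j) i
      have h7 : (imP z₀ i - imP z i) * ξ j i ≤ r * (δ⁻¹ * ∑ i, imP z₀ i * ξ j i) := by
        refine (le_abs_self _).trans ?_
        rw [abs_mul]
        exact mul_le_mul h2 h6 (abs_nonneg _) hr.le
      linarith
    have h8 := Finset.sum_le_sum fun i (_ : i ∈ Finset.univ) => h1 i
    rw [Finset.sum_sub_distrib] at h8
    simp only [Finset.sum_const, Finset.card_univ, Fintype.card_fin, nsmul_eq_mul] at h8
    refine le_trans (le_of_eq ?_) h8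
    simp only [Pi.smul_apply, smul_eq_mul, mul_assoc]
    rw [← Finset.mul_sum]
    simp only [r]
    field_simp
    ring
  let φ : ι → (Fin n → ℂ) →L[ℂ] ℂ := fun j =>
    ∑ i, (c j * (I * ξ j i)) • ContinuousLinearMap.proj i
  let f' : ι → (Fin n → ℂ) → (Fin n → ℂ) →L[ℂ] ℂ := fun j z =>
    cexp (I * ∑ i, (ξ j i : ℂ) * z i) • φ j
  have hφ : ∀ j, ‖φ j‖ ≤ ∑ i, ‖c j * (I * ξ j i)‖ := by
    intro j
    refine (norm_sum_le _ _).trans (Finset.sum_le_sum fun i _ => ?_)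
    rw [norm_smul]
    refine mul_le_of_le_one_right (norm_nonneg _) ?_
    exact ContinuousLinearMap.opNorm_le_bound _ zero_le_one fun v => by
      simpa using norm_le_pi_norm v i
  have hexp : ∀ z ∈ Metric.ball z₀ r, ∀ j, ‖cexp (I * ∑ i, (ξ j i : ℂ) * z i)‖ ≤
      Real.exp (-∑ i, ((1 / 2 : ℝ) • imP z₀) i * ξ j i) := by
    intro z hz j
    rw [norm_planeWave]
    exact Real.exp_le_exp.2 (neg_le_neg (himp z hz j))
  have hsum : Summable fun j => ∑ i, ‖c j * (I * ξ j i)‖ *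
      Real.exp (-∑ i, ((1 / 2 : ℝ) • imP z₀) i * ξ j i) :=
    summable_sum fun i _ => hc.mul_coord hξ i _ hhalf
  have hf'le : ∀ j, ∀ z ∈ Metric.ball z₀ r, ‖f' j z‖ ≤ ∑ i, ‖c j * (I * ξ j i)‖ *
      Real.exp (-∑ i, ((1 / 2 : ℝ) • imP z₀) i * ξ j i) := by
    intro j z hz
    rw [norm_smul, ← Finset.sum_mul, mul_comm]
    exact mul_le_mul (hφ j) (hexp z hz j) (norm_nonneg _)
      (Finset.sum_nonneg fun _ _ => norm_nonneg _)
  have hderiv := hasFDerivAt_tsum_of_isPreconnected (f := fun j z =>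
      c j * cexp (I * ∑ i, (ξ j i : ℂ) * z i)) (f' := f') hsum Metric.isOpen_ball
    (convex_ball z₀ r).isPreconnected (fun j z _ => ?_) hf'le (Metric.mem_ball_self hr) ?_
    (Metric.mem_ball_self hr)
  · refine ⟨hderiv.differentiableAt, fun i => ?_⟩
    rw [pd]
    have h1 : fderiv ℂ (planeWaveSum ξ c) z₀ = ∑' j, f' j z₀ := hderiv.fderiv
    have hs : Summable fun j => f' j z₀ :=
      Summable.of_norm_bounded hsum fun j => hf'le j z₀ (Metric.mem_ball_self hr)
    rw [h1, ← ContinuousLinearMap.apply_apply (𝕜 := ℂ) (Pi.single i (1 : ℂ)) (∑' j, f' j z₀),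
      ContinuousLinearMap.map_tsum _ hs, planeWaveSum]
    refine tsum_congr fun j => ?_
    simp [f', φ, Pi.single_apply]
    ring
  · have h1 : HasFDerivAt (fun z : Fin n → ℂ => I * ∑ i, (ξ j i : ℂ) * z i)
        (I • ∑ i, (ξ j i : ℂ) • ContinuousLinearMap.proj (R := ℂ) (φ := fun _ : Fin n => ℂ) i) z :=
      (HasFDerivAt.fun_sum fun i _ => (hasFDerivAt_apply i z).const_mul (ξ j i : ℂ)).const_mul I
    refine (h1.cexp.const_mul (c j)).congr_fderiv ?_
    simp only [f', φ, Finset.smul_sum, smul_smul]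
    exact Finset.sum_congr rfl fun i _ => by congr 1; ring
  · refine Summable.of_norm_bounded (hc _ hz₀) fun j => ?_
    rw [norm_mul, norm_planeWave]

theorem AbsSummableOnTube.differentiableOn (hξ : ∀ j, ξ j ∈ cone n)
    (hc : AbsSummableOnTube ξ c) : DifferentiableOn ℂ (planeWaveSum ξ c) (tube n) := fun _ hz =>
  (hc.differentiableAt_and_pd hξ hz).1.differentiableWithinAt

theorem AbsSummableOnTube.summable (hc : AbsSummableOnTube ξ c) {z : Fin n → ℂ}
    (hz : z ∈ tube n) : Summable fun j => c j * cexp (I * ∑ i, (ξ j i : ℂ) * z i) :=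
  Summable.of_norm_bounded (hc _ hz) fun j => by rw [norm_mul, norm_planeWave]

theorem AbsSummableOnTube.boxOp (hξ : ∀ j, ξ j ∈ cone n) (hc : AbsSummableOnTube ξ c) :
    AbsSummableOnTube ξ (fun j => c j * lor (ξ j)) ∧
      EqOn (BoxOp (planeWaveSum ξ c)) (planeWaveSum ξ (fun j => c j * lor (ξ j))) (tube n) := by
  have h2 : ∀ i, AbsSummableOnTube ξ (fun j => c j * (I * ξ j i) * (I * ξ j i)) := fun i =>
    (hc.mul_coord hξ i).mul_coord hξ i
  have hlor : ∀ j, c j * lor (ξ j) = -(2 * (c j * (I * ξ j 0) * (I * ξ j 0)) -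
      ∑ i, c j * (I * ξ j i) * (I * ξ j i)) := by
    intro j
    have : ∀ i, c j * (I * ξ j i) * (I * ξ j i) = -(c j * (ξ j i : ℂ) ^ 2) := fun i => by
      linear_combination c j * (ξ j i : ℂ) ^ 2 * I_sq
    simp only [this, Finset.sum_neg_distrib, ← Finset.mul_sum, lor]
    push_cast
    ring
  constructor
  · intro y hy
    refine Summable.of_nonneg_of_le (fun j => by positivity) (fun j => ?_)
      (((h2 0 y hy).mul_left 2).add (summable_sum fun i (_ : i ∈ Finset.univ) => h2 i y hy))
    beta_reduce
    rw [hlor j, ← mul_assoc 2 ‖_‖, ← Finset.sum_mul, ← add_mul, norm_neg]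
    gcongr
    refine (norm_sub_le _ _).trans (add_le_add (by simp) (norm_sum_le _ _))
  · intro z hz
    have hpd : ∀ i, pd i (pd i (planeWaveSum ξ c)) z =
        planeWaveSum ξ (fun j => c j * (I * ξ j i) * (I * ξ j i)) z := by
      intro i
      rw [eqOn_pd isOpen_tube (fun w hw => (hc.differentiableAt_and_pd hξ hw).2 i) i hz]
      exact ((hc.mul_coord hξ i).differentiableAt_and_pd hξ hz).2 i
    have hs : ∀ i, HasSum (fun j => c j * (I * ξ j i) * (I * ξ j i) *
        cexp (I * ∑ i, (ξ j i : ℂ) * z i)) (pd i (pd i (planeWaveSum ξ c)) z) := by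
      intro i
      rw [hpd i]
      exact ((h2 i).summable hz).hasSum
    rw [BoxOp, planeWaveSum]
    refine (HasSum.tsum_eq ?_).symm
    have h := (((hs 0).mul_left 2).sub (hasSum_sum fun i (_ : i ∈ Finset.univ) => hs i)).neg
    refine Eq.mp (congrArg (fun f => HasSum f _) (funext fun j => ?_)) h
    rw [hlor, neg_mul, sub_mul, Finset.sum_mul, mul_assoc 2]

theorem AbsSummableOnTube.iterate_boxOp (hξ : ∀ j, ξ j ∈ cone n) (hc : AbsSummableOnTube ξ c)
    (N : ℕ) : AbsSummableOnTube ξ (fun j => c j * (lor (ξ j) : ℂ) ^ N) ∧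
      EqOn (BoxOp^[N] (planeWaveSum ξ c)) (planeWaveSum ξ (fun j => c j * (lor (ξ j) : ℂ) ^ N))
        (tube n) := by
  induction N with
  | zero => simpa using ⟨hc, Set.eqOn_refl _ _⟩
  | succ N ih =>
    have h := ih.1.boxOp hξ
    simp only [mul_assoc, ← pow_succ] at h
    refine ⟨h.1, ?_⟩
    rw [Function.iterate_succ']
    exact (eqOn_boxOp isOpen_tube ih.2).trans h.2

end

section

variable {n : ℕ}

/-- The point `R x + i y`. -/
def horizontal (y : Fin n → ℝ) (R : ℝ) (x : Fin n → ℝ) : Fin n → ℂ :=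
  fun i => (R : ℂ) * x i + y i * I

/-- The conjugate character `x ↦ exp (-i R x · ξ)`. -/
def conjWave (ξ : Fin n → ℝ) (R : ℝ) (x : Fin n → ℝ) : ℂ :=
  cexp (-(I * ∑ i, (ξ i : ℂ) * (R * x i)))

theorem continuous_conjWave (ξ : Fin n → ℝ) (R : ℝ) : Continuous (conjWave ξ R) := by
  unfold conjWave; fun_prop

theorem norm_conjWave (ξ : Fin n → ℝ) (R : ℝ) (x : Fin n → ℝ) : ‖conjWave ξ R x‖ = 1 := by
  simp [conjWave, Complex.norm_exp]

/-- The Fourier coefficient at `ξ` of `x ↦ K (x + i y)`, smoothly averaged at scale `R` against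
the weight `φ`. -/
def smoothMean (y ξ : Fin n → ℝ) (φ : (Fin n → ℝ) → ℂ) (R : ℝ) (K : (Fin n → ℂ) → ℂ) : ℂ :=
  ∫ x, K (horizontal y R x) * conjWave ξ R x * φ x

/-- Smooth compactly supported functions. -/
def IsTestFunction (φ : (Fin n → ℝ) → ℂ) : Prop := ContDiff ℝ (⊤ : ℕ∞) φ ∧ HasCompactSupport φ

theorem IsTestFunction.fderiv_apply {φ : (Fin n → ℝ) → ℂ} (hφ : IsTestFunction φ)
    (v : Fin n → ℝ) : IsTestFunction (fun x => fderiv ℝ φ x v) :=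
  ⟨(hφ.1.fderiv_right (m := (⊤ : ℕ∞)) (by simp)).clm_apply contDiff_const,
    hφ.2.fderiv_apply (𝕜 := ℝ) v⟩

theorem continuous_horizontal (y : Fin n → ℝ) (R : ℝ) : Continuous (horizontal y R) := by
  unfold horizontal; fun_prop

theorem imP_horizontal (y : Fin n → ℝ) (R : ℝ) (x : Fin n → ℝ) : imP (horizontal y R x) = y := by
  ext i; simp [imP, horizontal]

variable [NeZero n] {y ξ : Fin n → ℝ} {φ : (Fin n → ℝ) → ℂ} {K : (Fin n → ℂ) → ℂ}

theorem horizontal_mem_tube (hy : y ∈ cone n) (R : ℝ) (x : Fin n → ℝ) :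
    horizontal y R x ∈ tube n := by
  rw [tube, mem_ofPred_eq, imP_horizontal]; exact hy

theorem continuous_comp_horizontal (hy : y ∈ cone n) (hK : ContinuousOn K (tube n)) (R : ℝ) :
    Continuous fun x => K (horizontal y R x) :=
  hK.comp_continuous (continuous_horizontal y R) (horizontal_mem_tube hy R)

theorem integrable_smoothMean (hy : y ∈ cone n) (hK : ContinuousOn K (tube n))
    (hφ : IsTestFunction φ) (R : ℝ) : Integrable fun x =>
      K (horizontal y R x) * conjWave ξ R x * φ x := by
  have h := continuous_comp_horizontal hy hK R
  have h2 := hφ.1.continuous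
  exact ((h.mul (continuous_conjWave ξ R)).mul h2).integrable_of_hasCompactSupport hφ.2.mul_left

/-- Integration by parts for smooth means. -/
theorem smoothMean_pd (hy : y ∈ cone n) (hK : DifferentiableOn ℂ K (tube n))
    (hφ : IsTestFunction φ) {R : ℝ} (hR : R ≠ 0) (i : Fin n) :
    smoothMean y ξ φ R (pd i K) = I * ξ i * smoothMean y ξ φ R K -
      (R : ℂ)⁻¹ * smoothMean y ξ (fun x => fderiv ℝ φ x (Pi.single i 1)) R K := by
  have hK' := hK.continuousOn
  have hpd := (hK.pd isOpen_tube i).continuousOn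
  have hφ' := hφ.fderiv_apply (Pi.single i (1 : ℝ))
  have hRC : (R : ℂ) ≠ 0 := by exact_mod_cast hR
  let f' : (Fin n → ℝ) → ℂ := fun x =>
    R * (pd i K (horizontal y R x) * conjWave ξ R x) - I * ξ i * R * (K (horizontal y R x) * conjWave ξ R x)
  have hline : ∀ x, HasLineDerivAt ℝ (fun x => K (horizontal y R x) * conjWave ξ R x) (f' x) x
      (Pi.single i 1) := by
    intro x
    have h1 : HasDerivAt (fun t : ℝ => horizontal y R (x + t • Pi.single i 1))
        ((R : ℂ) • Pi.single i 1) 0 := by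
      rw [hasDerivAt_pi]
      intro j
      have : HasDerivAt (fun t : ℝ => ((t * (Pi.single i 1 : Fin n → ℝ) j : ℝ) : ℂ))
          ((1 * (Pi.single i 1 : Fin n → ℝ) j : ℝ) : ℂ) 0 :=
        ((hasDerivAt_id (0 : ℝ)).mul_const _).ofReal_comp
      have h := ((this.const_add (x j : ℂ)).const_mul (R : ℂ)).add_const ((y j : ℂ) * I)
      convert h using 1
      · ext t; simp [horizontal]
      · by_cases hij : j = i <;> simp [hij]
    have h2 : HasDerivAt (fun t : ℝ => K (horizontal y R (x + t • Pi.single i 1)))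
        (R * pd i K (horizontal y R x)) 0 := by
      have hd : HasFDerivAt K (fderiv ℂ K (horizontal y R x)) (horizontal y R x) :=
        (hK.differentiableAt (isOpen_tube.mem_nhds (horizontal_mem_tube hy R x))).hasFDerivAt
      have hd' : HasFDerivAt K ((fderiv ℂ K (horizontal y R x)).restrictScalars ℝ)
          (horizontal y R (x + (0 : ℝ) • Pi.single i 1)) := by
        simpa using hd.restrictScalars ℝ
      have := hd'.comp_hasDerivAt (0 : ℝ) h1
      simpa [pd, Function.comp_def] using this
    have h3 : HasDerivAt (fun t : ℝ => conjWave ξ R (x + t • Pi.single i 1)) (-(I * ξ i * R) * conjWave ξ R x) 0 := by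
      have h4 : HasDerivAt (fun t : ℝ => -(I * ∑ j, (ξ j : ℂ) *
          (R * ((x + t • (Pi.single i 1 : Fin n → ℝ)) j : ℝ)))) (-(I * ξ i * R)) 0 := by
        have h5 : ∀ j ∈ Finset.univ, HasDerivAt (fun t : ℝ => (ξ j : ℂ) *
            (R * ((x + t • (Pi.single i 1 : Fin n → ℝ)) j : ℝ)))
            ((ξ j : ℂ) * (R * ((Pi.single i 1 : Fin n → ℝ) j : ℝ))) 0 := by
          intro j _
          have := ((hasDerivAt_id (0 : ℝ)).mul_const ((Pi.single i 1 : Fin n → ℝ) j)).const_add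
            (x j)
          simpa using ((this.ofReal_comp).const_mul (R : ℂ)).const_mul (ξ j : ℂ)
        refine ((HasDerivAt.fun_sum h5).const_mul I).fun_neg.congr_deriv ?_
        rw [Finset.sum_eq_single i (fun j _ hj => by simp [hj]) (by simp)]
        simp [mul_assoc]
      have := h4.cexp
      rw [mul_comm]
      simpa [conjWave] using this
    have := h2.mul h3
    refine HasDerivAt.congr_deriv this ?_
    simp only [f', zero_smul, add_zero]
    ring
  have hlineφ : ∀ x, HasLineDerivAt ℝ φ (fderiv ℝ φ x (Pi.single i 1)) x (Pi.single i 1) :=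
    fun x => ((hφ.1.differentiable (by simp)) x).hasFDerivAt.hasLineDerivAt _
  have hI1 := integrable_smoothMean (ξ := ξ) hy hpd hφ R
  have hI2 := integrable_smoothMean (ξ := ξ) hy hK' hφ R
  have hI3 := integrable_smoothMean (ξ := ξ) hy hK' hφ' R
  have hf'eq : ∀ x, f' x * φ x = R * (pd i K (horizontal y R x) * conjWave ξ R x * φ x) -
      I * ξ i * R * (K (horizontal y R x) * conjWave ξ R x * φ x) := fun x => by simp only [f']; ring
  have key := integral_bilinear_hasLineDerivAt_right_eq_neg_left_of_integrable
    (μ := volume) (B := ContinuousLinearMap.mul ℝ ℂ)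
    (f := fun x => K (horizontal y R x) * conjWave ξ R x) (f' := f') (g := φ)
    (g' := fun x => fderiv ℝ φ x (Pi.single i 1)) (v := Pi.single i 1)
    (by
      simp only [ContinuousLinearMap.mul_apply', hf'eq]
      exact (hI1.const_mul (R : ℂ)).sub (hI2.const_mul (I * ξ i * R)))
    (by simpa only [ContinuousLinearMap.mul_apply'] using hI3)
    (by simpa only [ContinuousLinearMap.mul_apply'] using hI2)
    (fun x _ => hline x) (fun x _ => hlineφ x)
  simp only [ContinuousLinearMap.mul_apply', hf'eq] at key
  rw [integral_sub (hI1.const_mul (R : ℂ)) (hI2.const_mul (I * ξ i * R)), integral_const_mul,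
    integral_const_mul] at key
  simp only [smoothMean]
  rw [key]
  field_simp
  ring

end

section

open Filter Topology

variable {n : ℕ} [NeZero n] {y ξ : Fin n → ℝ} {φ : (Fin n → ℝ) → ℂ} {K : (Fin n → ℂ) → ℂ}

/-- All smooth means of `K` over the horizontal through `i y` stay bounded at large scales. -/
def MeansBounded (y ξ : Fin n → ℝ) (K : (Fin n → ℂ) → ℂ) : Prop :=
  ∀ φ, IsTestFunction φ → ∃ C, ∀ R : ℝ, 1 ≤ R → ‖smoothMean y ξ φ R K‖ ≤ C

theorem IsTestFunction.integrable (hφ : IsTestFunction φ) : Integrable φ :=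
  hφ.1.continuous.integrable_of_hasCompactSupport hφ.2

theorem norm_smoothMean_le (hφ : IsTestFunction φ) {B : ℝ} (R : ℝ)
    (hB : ∀ x, ‖K (horizontal y R x)‖ ≤ B) : ‖smoothMean y ξ φ R K‖ ≤ B * ∫ x, ‖φ x‖ := by
  rw [← integral_const_mul]
  refine norm_integral_le_of_norm_le (hφ.integrable.norm.const_mul B) (ae_of_all _ fun x => ?_)
  rw [norm_mul, norm_mul, norm_conjWave, mul_one]
  exact mul_le_mul_of_nonneg_right (hB x) (norm_nonneg _)

theorem MeansBounded.of_bound {B : ℝ} (hB : ∀ R x, ‖K (horizontal y R x)‖ ≤ B) :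
    MeansBounded y ξ K := fun _ hφ => ⟨_, fun R _ => norm_smoothMean_le hφ R (hB R)⟩

theorem MeansBounded.pd (hb : MeansBounded y ξ K) (hy : y ∈ cone n)
    (hK : DifferentiableOn ℂ K (tube n)) (i : Fin n) :
    MeansBounded y ξ (pd i K) ∧ ∀ φ, IsTestFunction φ →
      Tendsto (fun R => smoothMean y ξ φ R (pd i K) - I * ξ i * smoothMean y ξ φ R K)
        atTop (𝓝 0) := by
  constructor
  · intro φ hφ
    obtain ⟨C, hC⟩ := hb φ hφ
    obtain ⟨C', hC'⟩ := hb _ (hφ.fderiv_apply (Pi.single i 1))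
    refine ⟨|ξ i| * C + C', fun R hR => ?_⟩
    rw [smoothMean_pd hy hK hφ (by linarith)]
    refine (norm_sub_le _ _).trans (add_le_add ?_ ?_)
    · simpa using mul_le_mul_of_nonneg_left (hC R hR) (abs_nonneg (ξ i))
    · have h1 : ‖(R : ℂ)⁻¹‖ ≤ 1 := by
        rw [norm_inv, norm_real, Real.norm_of_nonneg (by linarith)]
        exact inv_le_one_of_one_le₀ hR
      rw [norm_mul]
      exact (mul_le_of_le_one_left (norm_nonneg _) h1).trans (hC' R hR)
  · intro φ hφ
    obtain ⟨C', hC'⟩ := hb _ (hφ.fderiv_apply (Pi.single i 1))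
    refine squeeze_zero_norm' (a := fun R : ℝ => R⁻¹ * C') ?_ ?_
    · filter_upwards [eventually_ge_atTop 1] with R hR
      rw [smoothMean_pd hy hK hφ (by linarith), sub_sub_cancel_left, norm_neg, norm_mul, norm_inv,
        norm_real, Real.norm_of_nonneg (by linarith)]
      exact mul_le_mul_of_nonneg_left (hC' R hR) (by positivity)
    · simpa using (tendsto_inv_atTop_zero (𝕜 := ℝ)).mul_const C'

theorem smoothMean_boxOp (hy : y ∈ cone n) (hK : DifferentiableOn ℂ K (tube n))
    (hφ : IsTestFunction φ) (R : ℝ) :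
    smoothMean y ξ φ R (BoxOp K) = -(2 * smoothMean y ξ φ R (pd 0 (pd 0 K)) -
      ∑ i, smoothMean y ξ φ R (pd i (pd i K))) := by
  have hI : ∀ i, Integrable fun x =>
      pd i (pd i K) (horizontal y R x) * conjWave ξ R x * φ x := fun i =>
    integrable_smoothMean hy ((hK.pd isOpen_tube i).pd isOpen_tube i).continuousOn hφ R
  simp only [smoothMean]
  rw [← integral_finsetSum _ fun i _ => hI i, ← integral_const_mul,
    ← integral_sub ((hI 0).const_mul 2) (integrable_finsetSum _ fun i _ => hI i), ← integral_neg]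
  congr 1 with x
  simp only [BoxOp, ← Finset.sum_mul]
  ring

theorem MeansBounded.boxOp (hb : MeansBounded y ξ K) (hy : y ∈ cone n)
    (hK : DifferentiableOn ℂ K (tube n)) :
    MeansBounded y ξ (BoxOp K) ∧ ∀ φ, IsTestFunction φ →
      Tendsto (fun R => smoothMean y ξ φ R (BoxOp K) - lor ξ * smoothMean y ξ φ R K)
        atTop (𝓝 0) := by
  have h1 := fun i => hb.pd hy hK i
  have h2 := fun i => (h1 i).1.pd hy (hK.pd isOpen_tube i) i
  constructor
  · intro φ hφ
    choose C hC using fun i => (h2 i).1 φ hφ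
    refine ⟨2 * C 0 + ∑ i, C i, fun R hR => ?_⟩
    rw [smoothMean_boxOp hy hK hφ, norm_neg]
    refine (norm_sub_le _ _).trans (add_le_add ?_ ?_)
    · simpa using hC 0 R hR
    · exact (norm_sum_le _ _).trans (Finset.sum_le_sum fun i _ => hC i R hR)
  · intro φ hφ
    have h3 : ∀ i, Tendsto (fun R => smoothMean y ξ φ R (_root_.pd i (_root_.pd i K)) -
        (I * ξ i) ^ 2 * smoothMean y ξ φ R K) atTop (𝓝 0) := by
      intro i
      have := ((h2 i).2 φ hφ).add (((h1 i).2 φ hφ).const_mul (I * ξ i))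
      rw [mul_zero, add_zero] at this
      refine this.congr fun R => ?_
      ring
    have h4 := (((h3 0).const_mul 2).sub (tendsto_finsetSum Finset.univ fun i _ => h3 i)).neg
    simp only [mul_zero, Finset.sum_const_zero, sub_zero, neg_zero] at h4
    refine h4.congr fun R => ?_
    rw [smoothMean_boxOp hy hK hφ, Finset.sum_sub_distrib, ← Finset.sum_mul]
    simp only [lor, mul_pow, I_sq]
    push_cast
    rw [← Finset.mul_sum]
    ring

theorem MeansBounded.iterate_boxOp (hb : MeansBounded y ξ K) (hy : y ∈ cone n)
    (hK : DifferentiableOn ℂ K (tube n)) (N : ℕ) :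
    MeansBounded y ξ (BoxOp^[N] K) ∧ ∀ φ, IsTestFunction φ →
      Tendsto (fun R => smoothMean y ξ φ R (BoxOp^[N] K) - (lor ξ : ℂ) ^ N * smoothMean y ξ φ R K)
        atTop (𝓝 0) := by
  induction N with
  | zero => simpa using hb
  | succ N ih =>
    have h := ih.1.boxOp hy (hK.iterate_boxOp isOpen_tube N)
    simp only [Function.iterate_succ_apply']
    refine ⟨h.1, fun φ hφ => ?_⟩
    have := (h.2 φ hφ).add ((ih.2 φ hφ).const_mul (lor ξ : ℂ))
    rw [mul_zero, add_zero] at this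
    refine this.congr fun R => ?_
    ring

/-- The plane wave `z ↦ exp (i z · η)`. -/
def planeWave (η : Fin n → ℝ) (z : Fin n → ℂ) : ℂ := cexp (I * ∑ i, (η i : ℂ) * z i)

theorem hasFDerivAt_planeWave (η : Fin n → ℝ) (z : Fin n → ℂ) : HasFDerivAt (planeWave η)
    (planeWave η z • (I • ∑ i, (η i : ℂ) • ContinuousLinearMap.proj (R := ℂ) (φ := fun _ : Fin n => ℂ) i)) z := by
  refine HasFDerivAt.cexp (HasFDerivAt.const_mul ?_ I)
  refine HasFDerivAt.fun_sum fun i _ => ?_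
  exact HasFDerivAt.const_mul (hasFDerivAt_apply i z) _

theorem pd_planeWave (η : Fin n → ℝ) (i : Fin n) :
    pd i (planeWave η) = fun z => I * η i * planeWave η z := by
  ext z
  rw [pd, (hasFDerivAt_planeWave η z).fderiv]
  simp [Pi.single_apply]
  ring

theorem planeWave_horizontal (η : Fin n → ℝ) (R : ℝ) (x : Fin n → ℝ) :
    planeWave η (horizontal y R x) =
      Real.exp (-∑ i, y i * η i) * (starRingEnd ℂ) (conjWave η R x) := by
  rw [planeWave, conjWave, ← Complex.exp_conj, ofReal_exp, ← Complex.exp_add]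
  congr 1
  simp only [horizontal, mul_add, Finset.sum_add_distrib, Finset.mul_sum, map_neg, map_sum, map_mul,
    conj_I, conj_ofReal, ofReal_neg, ofReal_sum, ofReal_mul]
  rw [← Finset.sum_neg_distrib, ← Finset.sum_neg_distrib, add_comm]
  congr 1
  · refine Finset.sum_congr rfl fun i _ => ?_
    linear_combination (η i : ℂ) * y i * I_sq
  · refine Finset.sum_congr rfl fun i _ => ?_
    ring

theorem tendsto_smoothMean_planeWave (hy : y ∈ cone n) (hφ : IsTestFunction φ) (η : Fin n → ℝ)
    [Decidable (η = ξ)] :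
    Tendsto (fun R => smoothMean y ξ φ R (planeWave η)) atTop
      (𝓝 (if η = ξ then Real.exp (-∑ i, y i * η i) * ∫ x, φ x else 0)) := by
  split_ifs with h
  · subst h
    refine tendsto_const_nhds.congr fun R => ?_
    rw [smoothMean, ← integral_const_mul]
    congr 1 with x
    rw [planeWave_horizontal, mul_assoc (_ : ℂ) _ (conjWave η R x), ← normSq_eq_conj_mul_self,
      normSq_eq_norm_sq, norm_conjWave]
    simp
  · obtain ⟨i, hi⟩ := Function.ne_iff.1 h
    have hb : MeansBounded y ξ (planeWave η) := MeansBounded.of_bound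
      (B := Real.exp (-∑ i, y i * η i)) fun R x => by
        rw [planeWave, norm_planeWave, imP_horizontal]
    have hd : DifferentiableOn ℂ (planeWave η) (tube n) := fun z _ =>
      (hasFDerivAt_planeWave η z).differentiableAt.differentiableWithinAt
    have h2 := ((hb.pd hy hd i).2 φ hφ).const_mul (I * η i - I * ξ i)⁻¹
    rw [mul_zero] at h2
    refine h2.congr fun R => ?_
    have h3 : smoothMean y ξ φ R (fun z => I * η i * planeWave η z) =
        I * η i * smoothMean y ξ φ R (planeWave η) := by
      simp only [smoothMean]
      rw [← integral_const_mul]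
      congr 1 with x
      ring
    rw [pd_planeWave, h3, ← sub_mul, inv_mul_cancel_left₀]
    rw [← mul_sub, ← ofReal_sub]
    exact mul_ne_zero I_ne_zero (ofReal_ne_zero.2 (sub_ne_zero.2 hi))

theorem tendsto_smoothMean_planeWaveSum {ι : Type*} [Countable ι] {ξ : ι → Fin n → ℝ} {c : ι → ℂ}
    (hξi : Function.Injective ξ) (hc : AbsSummableOnTube ξ c)
    (hy : y ∈ cone n) (hφ : IsTestFunction φ) (j₀ : ι) :
    Tendsto (fun R => smoothMean y (ξ j₀) φ R (planeWaveSum ξ c)) atTop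
      (𝓝 (c j₀ * (Real.exp (-∑ i, y i * ξ j₀ i) * ∫ x, φ x))) := by
  classical
  have hnorm : ∀ j R x, ‖planeWave (ξ j) (horizontal y R x)‖ = Real.exp (-∑ i, y i * ξ j i) :=
    fun j R x => by rw [planeWave, norm_planeWave, imP_horizontal]
  have hswap : ∀ R, smoothMean y (ξ j₀) φ R (planeWaveSum ξ c) =
      ∑' j, c j * smoothMean y (ξ j₀) φ R (planeWave (ξ j)) := by
    intro R
    have hd : ∀ j, ContinuousOn (planeWave (ξ j)) (tube n) := fun j z _ =>
      (hasFDerivAt_planeWave (ξ j) z).continuousAt.continuousWithinAt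
    have hI : ∀ j, Integrable fun x =>
        c j * (planeWave (ξ j) (horizontal y R x) * conjWave (ξ j₀) R x * φ x) := fun j =>
      (integrable_smoothMean hy (hd j) hφ R).const_mul (c j)
    have hS := hasSum_integral_of_summable_integral_norm hI (by
      simp only [norm_mul, norm_conjWave, hnorm, mul_one, ← mul_assoc]
      simp_rw [integral_const_mul]
      exact (hc y hy).mul_right _)
    simp only [smoothMean]
    simp_rw [← integral_const_mul]
    rw [hS.tsum_eq]
    congr 1 with x
    rw [planeWaveSum, ← tsum_mul_right, ← tsum_mul_right]
    refine tsum_congr fun j => ?_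
    rw [planeWave]
    ring
  simp_rw [hswap]
  have hlim : ∑' j, c j * (if ξ j = ξ j₀ then Real.exp (-∑ i, y i * ξ j i) * ∫ x, φ x else 0) =
      c j₀ * (Real.exp (-∑ i, y i * ξ j₀ i) * ∫ x, φ x) := by
    rw [tsum_eq_single j₀ fun j hj => by rw [if_neg (hξi.ne hj), mul_zero], if_pos rfl]
  rw [← hlim]
  refine tendsto_tsum_of_dominated_convergence
    (bound := fun j => ‖c j‖ * Real.exp (-∑ i, y i * ξ j i) * ∫ x, ‖φ x‖)
    ((hc y hy).mul_right _) (fun j => (tendsto_smoothMean_planeWave hy hφ (ξ j)).const_mul _)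
    (Eventually.of_forall fun R j => ?_)
  rw [norm_mul, mul_assoc]
  exact mul_le_mul_of_nonneg_left (norm_smoothMean_le hφ R fun x => (hnorm j R x).le)
    (norm_nonneg _)

/-- A test weight of total mass one. -/
theorem exists_testFunction (n : ℕ) : ∃ ψ : (Fin n → ℝ) → ℝ,
    (∀ x, 0 ≤ ψ x) ∧ IsTestFunction (fun x => (ψ x : ℂ)) ∧ ∫ x, ψ x = 1 := by
  let f : ContDiffBump (0 : Fin n → ℝ) := ⟨1, 2, one_pos, one_lt_two⟩
  refine ⟨f.normed volume, fun x => f.nonneg_normed x, ⟨?_, ?_⟩, f.integral_normed⟩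
  · exact ofRealCLM.contDiff.comp f.contDiff_normed
  · exact f.hasCompactSupport_normed.comp_left ofReal_zero

/-- Bessel's inequality for smooth means. -/
theorem sum_sq_le_of_tendsto_smoothMean {ι : Type*} {ξ : ι → Fin n → ℝ} {a : ι → ℂ}
    (hξi : Function.Injective ξ) (hy : y ∈ cone n) (hK : ContinuousOn K (tube n)) {B : ℝ}
    (hB : ∀ R x, ‖K (horizontal y R x)‖ ≤ B) {ψ : (Fin n → ℝ) → ℝ} (hψ0 : ∀ x, 0 ≤ ψ x)
    (hψ : IsTestFunction fun x => (ψ x : ℂ)) (hψ1 : ∫ x, ψ x = 1) (J : Finset ι)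
    (ha : ∀ j ∈ J, Tendsto (fun R => smoothMean y (ξ j) (fun x => (ψ x : ℂ)) R K) atTop
      (𝓝 (a j))) :
    ∑ j ∈ J, ‖a j‖ ^ 2 ≤ B ^ 2 := by
  classical
  have hψ1' : ∫ x, (ψ x : ℂ) = 1 := by rw [integral_complex_ofReal, hψ1, ofReal_one]
  let b : ι → ℂ := fun j => a j * Real.exp (∑ i, y i * ξ j i)
  let P : (Fin n → ℂ) → ℂ := fun z => ∑ j ∈ J, b j * planeWave (ξ j) z
  have hpw : ∀ η : Fin n → ℝ, Continuous (planeWave η) := fun η =>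
    continuous_iff_continuousAt.2 fun z => (hasFDerivAt_planeWave η z).continuousAt
  have hP : ContinuousOn P (tube n) :=
    (continuous_finsetSum _ fun j _ => continuous_const.mul (hpw (ξ j))).continuousOn
  have hPh : ∀ R x, P (horizontal y R x) = ∑ j ∈ J, a j * (starRingEnd ℂ) (conjWave (ξ j) R x) := by
    intro R x
    refine Finset.sum_congr rfl fun j _ => ?_
    rw [planeWave_horizontal, Real.exp_neg, ofReal_inv]
    have : (Real.exp (∑ i, y i * ξ j i) : ℂ) ≠ 0 := ofReal_ne_zero.2 (Real.exp_ne_zero _)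
    simp only [b]
    field_simp
  have hsmP : ∀ j ∈ J, Tendsto (fun R => smoothMean y (ξ j) (fun x => (ψ x : ℂ)) R P) atTop
      (𝓝 (a j)) := by
    intro j hj
    have h1 : ∀ R, smoothMean y (ξ j) (fun x => (ψ x : ℂ)) R P =
        ∑ l ∈ J, b l * smoothMean y (ξ j) (fun x => (ψ x : ℂ)) R (planeWave (ξ l)) := by
      intro R
      simp only [smoothMean, P]
      simp_rw [← integral_const_mul]
      rw [← integral_finsetSum _ fun l _ =>
        (integrable_smoothMean hy (hpw (ξ l)).continuousOn hψ R).const_mul (b l)]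
      congr 1 with x
      rw [Finset.sum_mul, Finset.sum_mul]
      refine Finset.sum_congr rfl fun l _ => ?_
      ring
    simp_rw [h1]
    have h2 := tendsto_finsetSum J fun l _ =>
      (tendsto_smoothMean_planeWave (ξ := ξ j) hy hψ (ξ l)).const_mul (b l)
    convert h2 using 2
    rw [Finset.sum_eq_single j (fun l _ hl => by rw [if_neg (hξi.ne hl), mul_zero])
      (fun h => absurd hj h), if_pos rfl, hψ1', mul_one, Real.exp_neg, ofReal_inv]
    have : (Real.exp (∑ i, y i * ξ j i) : ℂ) ≠ 0 := ofReal_ne_zero.2 (Real.exp_ne_zero _)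
    simp only [b]
    field_simp
  have hlim : Tendsto (fun R => (∑ j ∈ J, (starRingEnd ℂ) (a j) *
      (2 * smoothMean y (ξ j) (fun x => (ψ x : ℂ)) R K -
        smoothMean y (ξ j) (fun x => (ψ x : ℂ)) R P)).re) atTop (𝓝 (∑ j ∈ J, ‖a j‖ ^ 2)) := by
    have h1 := tendsto_finsetSum J fun j hj =>
      (((ha j hj).const_mul 2).sub (hsmP j hj)).const_mul ((starRingEnd ℂ) (a j))
    have hval : (∑ j ∈ J, (starRingEnd ℂ) (a j) * (2 * a j - a j)).re = ∑ j ∈ J, ‖a j‖ ^ 2 := by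
      rw [re_sum]
      refine Finset.sum_congr rfl fun j _ => ?_
      rw [two_mul, add_sub_cancel_right, ← normSq_eq_conj_mul_self, normSq_eq_norm_sq, ofReal_re]
    rw [← hval]
    exact (continuous_re.tendsto _).comp h1
  refine le_of_tendsto hlim (Eventually.of_forall fun R => ?_)
  have hI : ∀ j, Integrable fun x => (starRingEnd ℂ) (a j) *
      (2 * (K (horizontal y R x) * conjWave (ξ j) R x * ψ x) -
        P (horizontal y R x) * conjWave (ξ j) R x * ψ x) := fun j =>
    (((integrable_smoothMean hy hK hψ R).const_mul 2).sub
      (integrable_smoothMean hy hP hψ R)).const_mul _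
  have h1 : ∑ j ∈ J, (starRingEnd ℂ) (a j) *
      (2 * smoothMean y (ξ j) (fun x => (ψ x : ℂ)) R K -
        smoothMean y (ξ j) (fun x => (ψ x : ℂ)) R P) =
      ∫ x, (2 * K (horizontal y R x) - P (horizontal y R x)) *
        (starRingEnd ℂ) (P (horizontal y R x)) * ψ x := by
    simp only [smoothMean]
    rw [integral_congr_ae (g := fun x => ∑ j ∈ J, (starRingEnd ℂ) (a j) *
      (2 * (K (horizontal y R x) * conjWave (ξ j) R x * ψ x) -
        P (horizontal y R x) * conjWave (ξ j) R x * ψ x)), integral_finsetSum _ fun j _ => hI j]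
    · refine Finset.sum_congr rfl fun j _ => ?_
      rw [integral_const_mul, integral_sub ((integrable_smoothMean hy hK hψ R).const_mul 2)
        (integrable_smoothMean hy hP hψ R), integral_const_mul]
    · refine ae_of_all _ fun x => ?_
      have : (starRingEnd ℂ) (P (horizontal y R x)) =
          ∑ j ∈ J, (starRingEnd ℂ) (a j) * conjWave (ξ j) R x := by
        rw [hPh, map_sum]
        simp
      simp only [this, Finset.mul_sum, Finset.sum_mul]
      refine Finset.sum_congr rfl fun j _ => ?_
      ring
  rw [h1]
  have hint : Integrable fun x => (2 * K (horizontal y R x) - P (horizontal y R x)) *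
        (starRingEnd ℂ) (P (horizontal y R x)) * ψ x := by
    have hc1 := continuous_comp_horizontal hy hK R
    have hc2 := continuous_comp_horizontal hy hP R
    have hc3 : Continuous fun x => (starRingEnd ℂ) (P (horizontal y R x)) :=
      continuous_conj.comp hc2
    exact ((((continuous_const.mul hc1).sub hc2).mul hc3).mul
      hψ.1.continuous).integrable_of_hasCompactSupport hψ.2.mul_left
  have hψint : Integrable ψ := by
    by_contra h
    rw [integral_undef h] at hψ1
    exact zero_ne_one hψ1
  have hre : (∫ x, (2 * K (horizontal y R x) - P (horizontal y R x)) *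
        (starRingEnd ℂ) (P (horizontal y R x)) * ψ x).re = ∫ x, ((2 * K (horizontal y R x) -
          P (horizontal y R x)) * (starRingEnd ℂ) (P (horizontal y R x)) * ψ x).re :=
    (integral_re hint).symm
  rw [hre]
  calc _ ≤ ∫ x, B ^ 2 * ψ x := by
        refine integral_mono hint.re (hψint.const_mul _) fun x => ?_
        simp only [re_mul_ofReal]
        refine mul_le_mul_of_nonneg_right ?_ (hψ0 x)
        refine le_trans ?_ (pow_le_pow_left₀ (norm_nonneg _) (hB R x) 2)
        rw [← normSq_eq_norm_sq, normSq_apply]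
        simp
        nlinarith [sq_nonneg ((K (horizontal y R x)).re - (P (horizontal y R x)).re),
          sq_nonneg ((K (horizontal y R x)).im - (P (horizontal y R x)).im)]
    _ = B ^ 2 := by rw [integral_const_mul, hψ1, mul_one]

end

section

open Filter Topology

variable {n : ℕ} [NeZero n]

/-- If `□^k G` grows at most like `Δ(Im z)^{-k}` and `□^m G` is the `□^m` of a series of plane
waves, then the coefficients of the series are square summable with the corresponding weights. -/
theorem sum_sq_le_of_iterate_boxOp_eqOn {ι : Type*} [Countable ι] {ξ : ι → Fin n → ℝ} {c : ι → ℂ}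
    (hξ : ∀ j, ξ j ∈ cone n) (hξi : Function.Injective ξ) (hc : AbsSummableOnTube ξ c)
    {G : (Fin n → ℂ) → ℂ} (hG : DifferentiableOn ℂ G (tube n)) {k m : ℕ} (hkm : k ≤ m)
    (hGF : EqOn (BoxOp^[m] G) (BoxOp^[m] (planeWaveSum ξ c)) (tube n)) {M : ℝ}
    (hM : ∀ z ∈ tube n, lor (imP z) ^ k * ‖BoxOp^[k] G z‖ ≤ M)
    {y : Fin n → ℝ} (hy : y ∈ cone n) (J : Finset ι) :
    ∑ j ∈ J, (‖c j‖ * lor (ξ j) ^ k * Real.exp (-∑ i, y i * ξ j i)) ^ 2 ≤ (M / lor y ^ k) ^ 2 := by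
  obtain ⟨N, rfl⟩ := Nat.exists_eq_add_of_le hkm
  have hK := hG.iterate_boxOp isOpen_tube k
  have hB : ∀ R x, ‖BoxOp^[k] G (horizontal y R x)‖ ≤ M / lor y ^ k := by
    intro R x
    have h := hM _ (horizontal_mem_tube hy R x)
    rw [imP_horizontal] at h
    rw [le_div_iff₀ (pow_pos hy.1 k), mul_comm]
    exact h
  obtain ⟨ψ, hψ0, hψ, hψ1⟩ := exists_testFunction n
  have hψ1' : ∫ x, (ψ x : ℂ) = 1 := by rw [integral_complex_ofReal, hψ1, ofReal_one]
  have hcm := hc.iterate_boxOp hξ (k + N)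
  have hlim : ∀ j ∈ J, Tendsto (fun R => smoothMean y (ξ j) (fun x => (ψ x : ℂ)) R (BoxOp^[k] G))
      atTop (𝓝 (c j * (lor (ξ j) : ℂ) ^ k * Real.exp (-∑ i, y i * ξ j i))) := by
    intro j _
    have hl : (lor (ξ j) : ℂ) ^ N ≠ 0 := pow_ne_zero _ (ofReal_ne_zero.2 (hξ j).1.ne')
    have hb : MeansBounded y (ξ j) (BoxOp^[k] G) := MeansBounded.of_bound hB
    have h1 := (hb.iterate_boxOp hy hK N).2 _ hψ
    have h2 := tendsto_smoothMean_planeWaveSum hξi hcm.1 hy hψ j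
    have h3 := (h2.sub h1).const_mul ((lor (ξ j) : ℂ) ^ N)⁻¹
    rw [hψ1'] at h3
    convert h3 using 2 with R
    · have h4 : smoothMean y (ξ j) (fun x => (ψ x : ℂ)) R (BoxOp^[N] (BoxOp^[k] G)) =
          smoothMean y (ξ j) (fun x => (ψ x : ℂ)) R
            (planeWaveSum ξ fun j => c j * (lor (ξ j) : ℂ) ^ (k + N)) := by
        simp only [smoothMean]
        congr 1 with x
        rw [← Function.iterate_add_apply, add_comm N k, hGF (horizontal_mem_tube hy R x),
          hcm.2 (horizontal_mem_tube hy R x)]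
      rw [h4, sub_sub_cancel, inv_mul_cancel_left₀ hl]
    · rw [pow_add]
      field_simp
      ring
  have h := sum_sq_le_of_tendsto_smoothMean hξi hy hK.continuousOn hB hψ0 hψ hψ1 J hlim
  refine le_trans (le_of_eq (Finset.sum_congr rfl fun j _ => ?_)) h
  rw [norm_mul, norm_mul, norm_pow, norm_real, norm_real, Real.norm_of_nonneg (hξ j).1.le,
    Real.norm_of_nonneg (Real.exp_pos _).le]

end

section

open Filter Topology

theorem one_add_pow_mul_exp_neg_le (q : ℕ) {t : ℝ} (ht : 0 ≤ t) :
    (1 + t) ^ q * Real.exp (-t) ≤ Real.exp 1 * q.factorial := by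
  have h := Real.pow_div_factorial_le_exp (1 + t) (by positivity) q
  rw [div_le_iff₀ (by positivity), Real.exp_add] at h
  rw [Real.exp_neg, ← div_eq_mul_inv, div_le_iff₀ (Real.exp_pos t)]
  linarith

/-- Dyadic sums of `t ^ m * exp (-t)` are uniformly bounded. -/
theorem sum_dyadic_pow_mul_exp_neg_le {m : ℕ} (hm : m ≠ 0) {W : ℝ} (hW : 0 < W) (N : ℕ) :
    ∑ a ∈ Finset.range N, (2 ^ a * W) ^ m * Real.exp (-(2 ^ a * W)) ≤
      2 * (Real.exp 1 * (m + 1).factorial) := by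
  set C := 2 * (Real.exp 1 * (m + 1).factorial)
  have key : ∀ t : ℝ, 0 < t → t ^ m * Real.exp (-t) ≤ C * (1 / (1 + t) - 1 / (1 + 2 * t)) := by
    intro t ht
    have h := one_add_pow_mul_exp_neg_le (m + 1) ht.le
    have h1 : C * (1 / (1 + t) - 1 / (1 + 2 * t)) = C * t / ((1 + t) * (1 + 2 * t)) := by
      field_simp
      ring
    rw [h1, le_div_iff₀ (by positivity)]
    obtain ⟨p, rfl⟩ := Nat.exists_eq_succ_of_ne_zero hm
    have h2 : t ^ p ≤ (1 + t) ^ p := pow_le_pow_left₀ ht.le (by linarith) p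
    calc t ^ (p + 1) * Real.exp (-t) * ((1 + t) * (1 + 2 * t))
        = t ^ p * ((1 + t) * (1 + 2 * t)) * (Real.exp (-t) * t) := by ring
      _ ≤ (1 + t) ^ p * ((1 + t) * (2 * (1 + t))) * (Real.exp (-t) * t) := by
          gcongr; linarith
      _ = 2 * ((1 + t) ^ (p + 1 + 1) * Real.exp (-t)) * t := by ring
      _ ≤ C * t := mul_le_mul_of_nonneg_right (mul_le_mul_of_nonneg_left h zero_le_two) ht.le
  calc _ ≤ ∑ a ∈ Finset.range N, (C * (1 / (1 + 2 ^ a * W)) - C * (1 / (1 + 2 ^ (a + 1) * W))) := by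
        refine Finset.sum_le_sum fun a _ => ?_
        have := key (2 ^ a * W) (by positivity)
        rw [← mul_sub, show (2 : ℝ) ^ (a + 1) * W = 2 * (2 ^ a * W) by ring]
        exact this
    _ = C * (1 / (1 + 2 ^ 0 * W)) - C * (1 / (1 + 2 ^ N * W)) := Finset.sum_range_sub' _ N
    _ ≤ C * 1 - 0 := by
        gcongr
        · rw [div_le_one (by positivity)]; linarith
        · positivity
    _ = C := by ring

/-- Dyadic sums of `r ^ (2 m) * (1 + 1 / r) ^ d * exp (-r ^ 2)` are uniformly bounded. -/
theorem sum_dyadic_gaussian_le {d m : ℕ} (hm : d + 1 ≤ 2 * m) {R : ℝ} (hR : 0 < R) (N : ℕ) :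
    ∑ l ∈ Finset.range N, (R / 2 ^ l) ^ (2 * m) * (1 + 1 / (R / 2 ^ l)) ^ d *
      Real.exp (-(R / 2 ^ l) ^ 2) ≤ 2 * (Real.exp 1 * (Real.exp 1 * (2 * m + 1).factorial)) := by
  set C := 2 * (Real.exp 1 * (Real.exp 1 * (2 * m + 1).factorial))
  have key : ∀ r : ℝ, 0 < r → r ^ (2 * m) * (1 + 1 / r) ^ d * Real.exp (-r ^ 2) ≤
      C * (1 / (1 + r / 2) - 1 / (1 + r)) := by
    intro r hr
    have h := one_add_pow_mul_exp_neg_le (2 * m + 1) hr.le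
    have h1 : C * (1 / (1 + r / 2) - 1 / (1 + r)) = C * (r / 2) / ((1 + r / 2) * (1 + r)) := by
      field_simp
      ring
    rw [h1, le_div_iff₀ (by positivity)]
    obtain ⟨p, hp⟩ := Nat.exists_eq_add_of_le hm
    have h2 : r ^ p ≤ (1 + r) ^ p := pow_le_pow_left₀ hr.le (by linarith) p
    have h3 : r ^ (2 * m) * (1 + 1 / r) ^ d = r * r ^ p * (1 + r) ^ d := by
      rw [hp, show 1 + 1 / r = (1 + r) / r by field_simp; ring, div_pow]
      field_simp
      ring
    have h4 : Real.exp (-r ^ 2) ≤ Real.exp 1 * Real.exp (-r) := by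
      rw [← Real.exp_add, Real.exp_le_exp]
      nlinarith [sq_nonneg (r - 1)]
    calc r ^ (2 * m) * (1 + 1 / r) ^ d * Real.exp (-r ^ 2) * ((1 + r / 2) * (1 + r))
        ≤ r * (1 + r) ^ p * (1 + r) ^ d * (Real.exp 1 * Real.exp (-r)) * ((1 + r) * (1 + r)) := by
          rw [h3]; gcongr; linarith
      _ = Real.exp 1 * ((1 + r) ^ (2 * m + 1) * Real.exp (-r)) * r := by rw [hp]; ring
      _ ≤ Real.exp 1 * (Real.exp 1 * (2 * m + 1).factorial) * r := by gcongr
      _ = C * (r / 2) := by simp only [C]; ring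
  calc _ ≤ ∑ l ∈ Finset.range N, (C * (1 / (1 + R / 2 ^ (l + 1))) - C * (1 / (1 + R / 2 ^ l))) := by
        refine Finset.sum_le_sum fun l _ => ?_
        have := key (R / 2 ^ l) (by positivity)
        rw [← mul_sub, show R / 2 ^ (l + 1) = R / 2 ^ l / 2 by rw [pow_succ, div_div]]
        exact this
    _ = C * (1 / (1 + R / 2 ^ N)) - C * (1 / (1 + R / 2 ^ 0)) :=
        Finset.sum_range_sub (fun l => C * (1 / (1 + R / 2 ^ l))) N
    _ ≤ C * 1 - 0 := by
        have : (0 : ℝ) < R / 2 ^ N := by positivity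
        gcongr
        · rw [div_le_one (by positivity)]; linarith
        · positivity
    _ = C := by ring

theorem exp_neg_sq_le_arctan_sub {r : ℝ} (hr : 0 < r) (x : ℝ) :
    Real.exp (-x ^ 2) ≤ 3 * (1 + 1 / r) * (Real.arctan (x + r) - Real.arctan x) := by
  set h := min r 1
  have hh : 0 < h := lt_min hr one_pos
  have hh1 : h ≤ 1 := min_le_right _ _
  obtain ⟨u, ⟨hu1, hu2⟩, hu⟩ := exists_hasDerivAt_eq_slope Real.arctan (fun u => 1 / (1 + u ^ 2))
    (show x < x + h by linarith) Real.continuous_arctan.continuousOn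
    fun u _ => Real.hasDerivAt_arctan u
  rw [add_sub_cancel_left, eq_div_iff hh.ne'] at hu
  have h1 : Real.arctan (x + h) ≤ Real.arctan (x + r) :=
    Real.arctan_mono (by linarith [min_le_left r 1])
  have h2 : 1 ≤ (1 + 1 / r) * h := by
    rcases le_total r 1 with h' | h'
    · rw [show h = r from min_eq_left h']
      field_simp
      linarith
    · rw [show h = 1 from min_eq_right h']
      have : 0 < 1 / r := by positivity
      linarith
  have h3 : Real.exp (-x ^ 2) ≤ 1 / (1 + x ^ 2) := by
    rw [Real.exp_neg, ← one_div]
    exact one_div_le_one_div_of_le (by positivity) (by linarith [Real.add_one_le_exp (x ^ 2)])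
  have h4 : 1 / (1 + x ^ 2) ≤ 3 * (1 / (1 + u ^ 2)) := by
    rw [mul_one_div, div_le_div_iff₀ (by positivity) (by positivity)]
    have : (u - x) ^ 2 ≤ 1 := by
      rw [sq_le_one_iff_abs_le_one, abs_le]; constructor <;> linarith
    nlinarith [sq_nonneg (u - 2 * x)]
  have h5 : 0 < 1 / (1 + u ^ 2) := by positivity
  calc Real.exp (-x ^ 2) ≤ 3 * (1 / (1 + u ^ 2)) * 1 := by linarith
    _ ≤ 3 * (1 / (1 + u ^ 2)) * ((1 + 1 / r) * h) := by gcongr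
    _ = 3 * (1 + 1 / r) * (Real.arctan (x + h) - Real.arctan x) := by rw [← hu]; ring
    _ ≤ _ := by gcongr

/-- Riemann sums of a translated Gaussian over an arithmetic progression. -/
theorem sum_exp_neg_sq_le {r : ℝ} (hr : 0 < r) (c : ℝ) (N : ℕ) :
    ∑ t ∈ Finset.range N, Real.exp (-(r * t + c) ^ 2) ≤ 3 * Real.pi * (1 + 1 / r) := by
  calc _ ≤ ∑ t ∈ Finset.range N, 3 * (1 + 1 / r) *
        (Real.arctan (r * (t + 1 : ℕ) + c) - Real.arctan (r * t + c)) := by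
        refine Finset.sum_le_sum fun t _ => ?_
        have := exp_neg_sq_le_arctan_sub hr (r * t + c)
        rwa [show r * t + c + r = r * (t + 1 : ℕ) + c by push_cast; ring] at this
    _ = 3 * (1 + 1 / r) * (Real.arctan (r * N + c) - Real.arctan (r * (0 : ℕ) + c)) := by
        rw [← Finset.mul_sum, Finset.sum_range_sub fun t : ℕ => Real.arctan (r * t + c)]
    _ ≤ 3 * (1 + 1 / r) * Real.pi := by
        have h : ∀ x y, Real.arctan x - Real.arctan y ≤ Real.pi := fun x y => by
          linarith [Real.arctan_lt_pi_div_two x, Real.neg_pi_div_two_lt_arctan y]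
        gcongr
        exact h _ _
    _ = _ := by ring

end

section

open Filter Topology

variable {d : ℕ}

theorem lor_eq_sq_sub_sq_sub_sum (y : Fin (d + 2) → ℝ) :
    lor y = y 0 ^ 2 - y 1 ^ 2 - ∑ i : Fin d, y i.succ.succ ^ 2 := by
  rw [lor, Fin.sum_univ_succ, Fin.sum_univ_succ, Fin.succ_zero_eq_one]
  ring

/-- The point `ξ` with `ξ₀ + ξ₁ = 1`, with remaining coordinates `v`, and with `Δ(ξ) = s`. -/
def paraboloidPoint (s : ℝ) (v : Fin d → ℝ) : Fin (d + 2) → ℝ :=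
  Fin.cons ((1 + (∑ i, v i ^ 2 + s)) / 2) (Fin.cons ((1 - (∑ i, v i ^ 2 + s)) / 2) v)

theorem paraboloidPoint_zero (s : ℝ) (v : Fin d → ℝ) :
    paraboloidPoint s v 0 = (1 + (∑ i, v i ^ 2 + s)) / 2 := rfl

theorem paraboloidPoint_one (s : ℝ) (v : Fin d → ℝ) :
    paraboloidPoint s v 1 = (1 - (∑ i, v i ^ 2 + s)) / 2 := rfl

theorem paraboloidPoint_succ_succ (s : ℝ) (v : Fin d → ℝ) (i : Fin d) :
    paraboloidPoint s v i.succ.succ = v i := rfl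

theorem lor_paraboloidPoint (s : ℝ) (v : Fin d → ℝ) : lor (paraboloidPoint s v) = s := by
  simp only [lor_eq_sq_sub_sq_sub_sum, paraboloidPoint_zero, paraboloidPoint_one,
    paraboloidPoint_succ_succ]
  ring

theorem paraboloidPoint_mem_cone {s : ℝ} (hs : 0 < s) (v : Fin d → ℝ) :
    paraboloidPoint s v ∈ cone (d + 2) := by
  refine ⟨by rwa [lor_paraboloidPoint], ?_⟩
  rw [paraboloidPoint_zero]
  positivity

theorem sub_pos_of_mem_cone {y : Fin (d + 2) → ℝ} (hy : y ∈ cone (d + 2)) : 0 < y 0 - y 1 := by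
  have h1 := hy.1
  rw [lor_eq_sq_sub_sq_sub_sum] at h1
  have h2 : 0 ≤ ∑ i : Fin d, y i.succ.succ ^ 2 := by positivity
  have h3 := abs_lt_of_sq_lt_sq (show y 1 ^ 2 < y 0 ^ 2 by linarith) hy.2.le
  linarith [(abs_lt.1 h3).2]

theorem dot_paraboloidPoint {y : Fin (d + 2) → ℝ} (hy : y 0 - y 1 ≠ 0) (s : ℝ) (v : Fin d → ℝ) :
    ∑ i, y i * paraboloidPoint s v i = lor y / (2 * (y 0 - y 1)) + (y 0 - y 1) / 2 * s +
      (y 0 - y 1) / 2 * ∑ i, (v i + y i.succ.succ / (y 0 - y 1)) ^ 2 := by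
  rw [Fin.sum_univ_succ, Fin.sum_univ_succ, Fin.succ_zero_eq_one, lor_eq_sq_sub_sq_sub_sum]
  simp only [paraboloidPoint_zero, paraboloidPoint_one, paraboloidPoint_succ_succ, add_sq, div_pow,
    Finset.sum_add_distrib]
  rw [← Finset.sum_div]
  have : ∑ i, 2 * v i * (y i.succ.succ / (y 0 - y 1)) =
      2 / (y 0 - y 1) * ∑ i : Fin d, y i.succ.succ * v i := by
    rw [Finset.mul_sum]
    refine Finset.sum_congr rfl fun i _ => ?_
    ring
  rw [this]
  field_simp
  ring

/-- Indices of the frequencies: a scale `a`, a distance `l ≤ a` to the boundary of the cone, and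
a dyadic grid point. -/
abbrev FreqIndex (d : ℕ) : Type := Σ a : ℕ, Σ l : Fin (a + 1), (Fin d → Fin (2 ^ (l : ℕ)))

/-- The frequency of size about `2 ^ a` at relative height `4 ^ (-l)` over the dyadic grid point
`2 ^ (-l) j`. -/
def freq (a l : ℕ) (j : Fin d → Fin (2 ^ l)) : Fin (d + 2) → ℝ :=
  (2 : ℝ) ^ a • paraboloidPoint (1 / 4 ^ l) (fun i => (j i : ℝ) / 2 ^ l)

theorem freq_mem_cone (a l : ℕ) (j : Fin d → Fin (2 ^ l)) : freq a l j ∈ cone (d + 2) :=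
  smul_mem_cone (paraboloidPoint_mem_cone (by positivity) _) (by positivity)

theorem lor_freq (a l : ℕ) (j : Fin d → Fin (2 ^ l)) : lor (freq a l j) = 4 ^ a / 4 ^ l := by
  rw [freq, lor_smul, lor_paraboloidPoint, ← pow_mul, mul_comm a 2, pow_mul]
  norm_num
  ring

theorem injective_freq :
    Function.Injective fun p : FreqIndex d => freq p.1 p.2.1 p.2.2 := by
  rintro ⟨a, l, j⟩ ⟨a', l', j'⟩ h
  simp only at h
  have h01 : ∀ (a l : ℕ) (j : Fin d → Fin (2 ^ l)), freq a l j 0 + freq a l j 1 = 2 ^ a := by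
    intro a l j
    simp only [freq, Pi.smul_apply, smul_eq_mul, paraboloidPoint_zero, paraboloidPoint_one]
    ring
  have ha : (2 : ℝ) ^ a = 2 ^ a' := by rw [← h01 a l j, ← h01 a' l' j', h]
  obtain rfl : a = a' := pow_right_injective₀ (by norm_num) (by norm_num) ha
  have hl : (4 : ℝ) ^ a / 4 ^ (l : ℕ) = 4 ^ a / 4 ^ (l' : ℕ) := by
    rw [← lor_freq a l j, ← lor_freq a l' j', h]
  rw [div_eq_div_iff (by positivity) (by positivity), mul_right_inj' (by positivity)] at hl
  obtain rfl : l = l' := Fin.ext (pow_right_injective₀ (by norm_num) (by norm_num) hl.symm)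
  obtain rfl : j = j' := by
    ext i
    have hi := congrFun h i.succ.succ
    simp only [freq, Pi.smul_apply, smul_eq_mul, paraboloidPoint_succ_succ] at hi
    rw [mul_right_inj' (by positivity), div_left_inj' (by positivity)] at hi
    exact_mod_cast hi
  rfl

theorem dot_freq {y : Fin (d + 2) → ℝ} (hy : y ∈ cone (d + 2)) (a l : ℕ)
    (j : Fin d → Fin (2 ^ l)) :
    ∑ i, y i * freq a l j i = 2 ^ a * (lor y / (2 * (y 0 - y 1))) +
      (√(2 ^ a * (y 0 - y 1) / 2) / 2 ^ l) ^ 2 +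
      ∑ i, (√(2 ^ a * (y 0 - y 1) / 2) / 2 ^ l * j i +
        √(2 ^ a * (y 0 - y 1) / 2) * (y i.succ.succ / (y 0 - y 1))) ^ 2 := by
  have hY := sub_pos_of_mem_cone hy
  have hsq : √(2 ^ a * (y 0 - y 1) / 2) ^ 2 = 2 ^ a * (y 0 - y 1) / 2 :=
    Real.sq_sqrt (by positivity)
  have h1 : ∀ i : Fin d, (√(2 ^ a * (y 0 - y 1) / 2) / 2 ^ l * j i +
        √(2 ^ a * (y 0 - y 1) / 2) * (y i.succ.succ / (y 0 - y 1))) ^ 2 =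
        2 ^ a * (y 0 - y 1) / 2 * ((j i : ℝ) / 2 ^ l + y i.succ.succ / (y 0 - y 1)) ^ 2 := by
    intro i
    linear_combination ((j i : ℝ) / 2 ^ l + y i.succ.succ / (y 0 - y 1)) ^ 2 * hsq
  have h2 : ∑ i, y i * freq a l j i = 2 ^ a * ∑ i, y i *
      paraboloidPoint (1 / 4 ^ l) (fun i => (j i : ℝ) / 2 ^ l) i := by
    rw [Finset.mul_sum]
    refine Finset.sum_congr rfl fun i _ => ?_
    simp only [freq, Pi.smul_apply, smul_eq_mul]
    ring
  rw [h2, dot_paraboloidPoint hY.ne', Finset.sum_congr rfl fun i _ => h1 i, ← Finset.mul_sum,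
    div_pow, hsq, ← pow_mul, mul_comm l 2, pow_mul]
  norm_num
  ring

/-- The plane waves on one dyadic layer. -/
theorem sum_layer_le {m : ℕ} {y : Fin (d + 2) → ℝ} (hy : y ∈ cone (d + 2)) (a l : ℕ) :
    ∑ j : Fin d → Fin (2 ^ l), (lor y * lor (freq a l j)) ^ m *
      Real.exp (-∑ i, y i * freq a l j i) ≤
    4 ^ m * (3 * Real.pi) ^ d * ((2 ^ a * (lor y / (2 * (y 0 - y 1)))) ^ m *
      Real.exp (-(2 ^ a * (lor y / (2 * (y 0 - y 1)))))) *
      ((√(2 ^ a * (y 0 - y 1) / 2) / 2 ^ l) ^ (2 * m) *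
        (1 + 1 / (√(2 ^ a * (y 0 - y 1) / 2) / 2 ^ l)) ^ d *
        Real.exp (-(√(2 ^ a * (y 0 - y 1) / 2) / 2 ^ l) ^ 2)) := by
  have hY := sub_pos_of_mem_cone hy
  have hD := hy.1
  set w := 2 ^ a * (lor y / (2 * (y 0 - y 1))) with hw
  set ρ := √(2 ^ a * (y 0 - y 1) / 2) with hρ
  set r := ρ / 2 ^ l with hr
  have hρ2 : ρ ^ 2 = 2 ^ a * (y 0 - y 1) / 2 := Real.sq_sqrt (by positivity)
  have hρ0 : 0 < ρ := Real.sqrt_pos.2 (by positivity)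
  have hr0 : 0 < r := by positivity
  have hw0 : 0 < w := by positivity
  have h1 : ∀ j : Fin d → Fin (2 ^ l), lor y * lor (freq a l j) = 4 * w * r ^ 2 := by
    intro j
    rw [lor_freq, hr, div_pow, hρ2, ← pow_mul, mul_comm l 2, pow_mul, hw,
      show (4 : ℝ) ^ a = 2 ^ a * 2 ^ a by rw [← mul_pow]; norm_num]
    norm_num
    field_simp
    norm_num
  have h2 : ∀ j : Fin d → Fin (2 ^ l), Real.exp (-∑ i, y i * freq a l j i) =
      Real.exp (-w) * Real.exp (-r ^ 2) *
        ∏ i, Real.exp (-(r * j i + ρ * (y i.succ.succ / (y 0 - y 1))) ^ 2) := by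
    intro j
    rw [dot_freq hy, ← Real.exp_sum, ← Real.exp_add, ← Real.exp_add, Finset.sum_neg_distrib]
    congr 1
    ring
  have h3 : ∑ j : Fin d → Fin (2 ^ l),
      ∏ i, Real.exp (-(r * j i + ρ * (y i.succ.succ / (y 0 - y 1))) ^ 2) ≤
      (3 * Real.pi * (1 + 1 / r)) ^ d := by
    rw [← Fintype.piFinset_univ, Finset.sum_prod_piFinset Finset.univ fun (i : Fin d) (t : Fin (2 ^ l)) =>
      Real.exp (-(r * t + ρ * (y i.succ.succ / (y 0 - y 1))) ^ 2)]
    calc _ ≤ ∏ _i : Fin d, (3 * Real.pi * (1 + 1 / r)) := by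
          refine Finset.prod_le_prod (fun i _ => by positivity) fun i _ => ?_
          rw [Fin.sum_univ_eq_sum_range fun t : ℕ =>
            Real.exp (-(r * t + ρ * (y i.succ.succ / (y 0 - y 1))) ^ 2)]
          exact sum_exp_neg_sq_le hr0 _ _
      _ = _ := by simp
  simp only [h1, h2]
  rw [← Finset.mul_sum, ← Finset.mul_sum]
  calc _ ≤ (4 * w * r ^ 2) ^ m * (Real.exp (-w) * Real.exp (-r ^ 2) *
        (3 * Real.pi * (1 + 1 / r)) ^ d) := by gcongr
    _ = _ := by rw [mul_pow _ (1 + 1 / r), mul_pow _ (r ^ 2), mul_pow 4 w, ← pow_mul]; ring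

/-- Uniform bound for the weighted sum over all plane waves. -/
theorem exists_sum_le {m : ℕ} (hm : d + 1 ≤ 2 * m) : ∃ C : ℝ, ∀ y ∈ cone (d + 2),
    ∀ J : Finset (FreqIndex d), ∑ p ∈ J, (lor y * lor (freq p.1 p.2.1 p.2.2)) ^ m *
      Real.exp (-∑ i, y i * freq p.1 p.2.1 p.2.2 i) ≤ C := by
  set C₁ : ℝ := 2 * (Real.exp 1 * (Real.exp 1 * (2 * m + 1).factorial)) with hC₁
  refine ⟨4 ^ m * (3 * Real.pi) ^ d * (2 * (Real.exp 1 * (m + 1).factorial)) * C₁,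
    fun y hy J => ?_⟩
  have hY := sub_pos_of_mem_cone hy
  have hD := hy.1
  set f : FreqIndex d → ℝ := fun p => (lor y * lor (freq p.1 p.2.1 p.2.2)) ^ m *
      Real.exp (-∑ i, y i * freq p.1 p.2.1 p.2.2 i)
  have hf : ∀ p, 0 ≤ f p := fun p =>
    mul_nonneg (pow_nonneg (mul_pos hD (freq_mem_cone _ _ _).1).le _) (Real.exp_pos _).le
  obtain ⟨N, hN⟩ : ∃ N, ∀ p ∈ J, p.1 < N :=
    ⟨J.sup (fun p => p.1) + 1, fun p hp => Nat.lt_succ_of_le (Finset.le_sup (f := fun p => p.1) hp)⟩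
  have hJ : J ⊆ (Finset.range N).sigma fun _ => Finset.univ := fun p hp => by
    simpa using hN p hp
  refine (Finset.sum_le_sum_of_subset_of_nonneg hJ fun p _ _ => hf p).trans ?_
  rw [Finset.sum_sigma]
  have hlayer : ∀ a, ∑ q, f ⟨a, q⟩ ≤ 4 ^ m * (3 * Real.pi) ^ d *
      ((2 ^ a * (lor y / (2 * (y 0 - y 1)))) ^ m *
        Real.exp (-(2 ^ a * (lor y / (2 * (y 0 - y 1)))))) * C₁ := by
    intro a
    have hρ : 0 < √(2 ^ a * (y 0 - y 1) / 2) := Real.sqrt_pos.2 (by positivity)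
    rw [Fintype.sum_sigma]
    refine le_trans (Finset.sum_le_sum fun l _ => sum_layer_le hy a l) ?_
    rw [← Finset.mul_sum, Fin.sum_univ_eq_sum_range fun l : ℕ =>
      (√(2 ^ a * (y 0 - y 1) / 2) / 2 ^ l) ^ (2 * m) *
        (1 + 1 / (√(2 ^ a * (y 0 - y 1) / 2) / 2 ^ l)) ^ d *
        Real.exp (-(√(2 ^ a * (y 0 - y 1) / 2) / 2 ^ l) ^ 2)]
    gcongr
    exact sum_dyadic_gaussian_le hm hρ _
  refine (Finset.sum_le_sum fun a _ => hlayer a).trans ?_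
  rw [← Finset.sum_mul, ← Finset.mul_sum]
  gcongr
  exact sum_dyadic_pow_mul_exp_neg_le (by omega) (by positivity) N

end

section

open Filter Topology

variable {d : ℕ}

/-- The superposition of all the dyadic plane waves. -/
def dyadicWave (d : ℕ) : (Fin (d + 2) → ℂ) → ℂ :=
  planeWaveSum (fun p : FreqIndex d => freq p.1 p.2.1 p.2.2) fun _ => 1

theorem one_le_lor_freq (p : FreqIndex d) : 1 ≤ lor (freq p.1 p.2.1 p.2.2) := by
  rw [lor_freq, one_le_div (by positivity)]
  exact pow_le_pow_right₀ (by norm_num) (Nat.lt_succ_iff.1 p.2.1.2)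

theorem absSummableOnTube_freq :
    AbsSummableOnTube (fun p : FreqIndex d => freq p.1 p.2.1 p.2.2) fun _ => 1 := by
  intro y hy
  obtain ⟨C, hC⟩ := exists_sum_le (d := d) (m := d + 1) (by omega)
  refine summable_of_sum_le (c := C / lor y ^ (d + 1)) (fun p => by positivity) fun J => ?_
  rw [le_div_iff₀ (pow_pos hy.1 _), Finset.sum_mul]
  refine (Finset.sum_le_sum fun p _ => ?_).trans (hC y hy J)
  rw [norm_one, one_mul, mul_comm]
  refine mul_le_mul_of_nonneg_right ?_ (Real.exp_pos _).le
  exact pow_le_pow_left₀ hy.1.le (le_mul_of_one_le_right hy.1.le (one_le_lor_freq p)) _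

theorem differentiableOn_dyadicWave : DifferentiableOn ℂ (dyadicWave d) (tube (d + 2)) :=
  absSummableOnTube_freq.differentiableOn fun _ => freq_mem_cone _ _ _

theorem exists_bound_dyadicWave {m : ℕ} (hm : d + 1 ≤ 2 * m) : ∃ M : ℝ,
    ∀ z ∈ tube (d + 2), lor (imP z) ^ m * ‖BoxOp^[m] (dyadicWave d) z‖ ≤ M := by
  obtain ⟨C, hC⟩ := exists_sum_le hm
  refine ⟨C, fun z hz => ?_⟩
  have hD : 0 < lor (imP z) := hz.1
  obtain ⟨hs, heq⟩ := (absSummableOnTube_freq (d := d)).iterate_boxOp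
    (fun _ => freq_mem_cone _ _ _) m
  rw [dyadicWave, heq hz, mul_comm, ← le_div_iff₀ (pow_pos hD m)]
  refine (norm_tsum_le_tsum_norm (hs.summable hz).norm).trans ?_
  refine Real.tsum_le_of_sum_le (fun _ => norm_nonneg _) fun J => ?_
  rw [le_div_iff₀ (pow_pos hD m), Finset.sum_mul]
  refine le_trans (le_of_eq (Finset.sum_congr rfl fun p _ => ?_)) (hC _ hz J)
  rw [norm_mul, norm_planeWave, one_mul, norm_pow, norm_real,
    Real.norm_of_nonneg (zero_le_one.trans (one_le_lor_freq p)), mul_pow]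
  ring

theorem dot_single_freq_le (a l : ℕ) (j : Fin d → Fin (2 ^ l)) :
    ∑ i, ((1 / 2 ^ a : ℝ) • Pi.single 0 1 : Fin (d + 2) → ℝ) i * freq a l j i ≤ ((d : ℝ) + 2) / 2 := by
  rw [Finset.sum_eq_single 0 (fun i _ hi => by simp [hi]) (by simp)]
  simp only [freq, Pi.smul_apply, smul_eq_mul, paraboloidPoint_zero, Pi.single_eq_same]
  have h1 : ∑ i, ((j i : ℝ) / 2 ^ l) ^ 2 ≤ (d : ℝ) := by
    calc _ ≤ ∑ _i : Fin d, (1 : ℝ) := by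
          refine Finset.sum_le_sum fun i _ => pow_le_one₀ (by positivity) ?_
          rw [div_le_one (by positivity)]
          exact_mod_cast (j i).2.le
      _ = d := by simp
  have h2 : (1 : ℝ) / 4 ^ l ≤ 1 := by
    rw [div_le_one (by positivity)]
    exact one_le_pow₀ (by norm_num)
  rw [mul_one, one_div_mul_eq_div, mul_div_cancel_left₀ _ (by positivity)]
  linarith

theorem lor_smul_single (a : ℕ) :
    lor ((1 / 2 ^ a : ℝ) • Pi.single 0 1 : Fin (d + 2) → ℝ) = 1 / 4 ^ a := by
  rw [lor_smul, lor, Finset.sum_eq_single 0 (fun i _ hi => by simp [hi]) (by simp), div_pow,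
    ← pow_mul, mul_comm a 2, pow_mul]
  norm_num

theorem le_sum_layers {k : ℕ} (hk : 4 * k ≤ d) (a : ℕ) :
    ((a : ℝ) + 1) * (4 ^ a) ^ (2 * k) * Real.exp (-(d + 2)) ≤
      ∑ p ∈ ({a} : Finset ℕ).sigma fun a => (Finset.univ : Finset
          (Σ l : Fin (a + 1), (Fin d → Fin (2 ^ (l : ℕ))))),
        (‖(1 : ℂ)‖ * lor (freq p.1 p.2.1 p.2.2) ^ k * Real.exp
          (-∑ i, ((1 / 2 ^ a : ℝ) • Pi.single 0 1 : Fin (d + 2) → ℝ) i *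
            freq p.1 p.2.1 p.2.2 i)) ^ 2 := by
  rw [Finset.sum_sigma, Finset.sum_singleton, Fintype.sum_sigma]
  have hl : ∀ l : Fin (a + 1), (4 ^ a : ℝ) ^ (2 * k) * Real.exp (-(d + 2)) ≤
      ∑ j : Fin d → Fin (2 ^ (l : ℕ)), (‖(1 : ℂ)‖ * lor (freq a l j) ^ k * Real.exp
          (-∑ i, ((1 / 2 ^ a : ℝ) • Pi.single 0 1 : Fin (d + 2) → ℝ) i * freq a l j i)) ^ 2 := by
    intro l
    have hcard : (Finset.univ : Finset (Fin d → Fin (2 ^ (l : ℕ)))).card = (2 ^ (l : ℕ)) ^ d := by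
      simp
    have hterm : ∀ j : Fin d → Fin (2 ^ (l : ℕ)),
        (4 ^ a / 4 ^ (l : ℕ)) ^ (2 * k) * Real.exp (-(d + 2)) ≤
        (‖(1 : ℂ)‖ * lor (freq a l j) ^ k * Real.exp
          (-∑ i, ((1 / 2 ^ a : ℝ) • Pi.single 0 1 : Fin (d + 2) → ℝ) i * freq a l j i)) ^ 2 := by
      intro j
      rw [norm_one, one_mul, mul_pow, lor_freq, ← pow_mul, mul_comm k 2, ← Real.exp_nat_mul]
      gcongr
      have := dot_single_freq_le a l j
      push_cast
      linarith
    have h4 : (4 ^ (l : ℕ) : ℝ) ^ (2 * k) ≤ (2 ^ (l : ℕ)) ^ d := by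
      calc (4 ^ (l : ℕ) : ℝ) ^ (2 * k) = (2 ^ (l : ℕ)) ^ (4 * k) := by
            rw [show (4 : ℝ) = 2 ^ 2 by norm_num, ← pow_mul, ← pow_mul, ← pow_mul]
            congr 1
            ring
        _ ≤ _ := pow_le_pow_right₀ (one_le_pow₀ one_le_two) hk
    calc (4 ^ a : ℝ) ^ (2 * k) * Real.exp (-(d + 2))
        = (4 ^ (l : ℕ)) ^ (2 * k) * ((4 ^ a / 4 ^ (l : ℕ)) ^ (2 * k) * Real.exp (-(d + 2))) := by
          rw [div_pow]
          field_simp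
      _ ≤ (2 ^ (l : ℕ)) ^ d * ((4 ^ a / 4 ^ (l : ℕ)) ^ (2 * k) * Real.exp (-(d + 2))) := by gcongr
      _ = ∑ _j : Fin d → Fin (2 ^ (l : ℕ)),
          (4 ^ a / 4 ^ (l : ℕ)) ^ (2 * k) * Real.exp (-(d + 2)) := by
          rw [Finset.sum_const, hcard, nsmul_eq_mul]
          push_cast
          rfl
      _ ≤ _ := Finset.sum_le_sum fun j _ => hterm j
  calc _ = ∑ _l : Fin (a + 1), (4 ^ a : ℝ) ^ (2 * k) * Real.exp (-(d + 2)) := by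
        simp [mul_assoc]
    _ ≤ _ := Finset.sum_le_sum fun l _ => hl l

end

/-- Proposition: if every `F` in the Bloch space has a representative
modulo `Ker □^m` with `Δ(Im·)^k □^k F̃` bounded, then `k > (n/2 − 1)/2`. -/
theorem bloch_necessary_condition (n : ℕ) [NeZero n] (hn : 3 ≤ n) (k m : ℕ)
    (hm : (n : ℝ) / 2 - 1 < (m : ℝ))
    (H : ∀ F : (Fin n → ℂ) → ℂ, DifferentiableOn ℂ F (tube n) →
      (∃ M : ℝ, ∀ z ∈ tube n, lor (imP z) ^ m * ‖BoxOp^[m] F z‖ ≤ M) →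
      ∃ G : (Fin n → ℂ) → ℂ, DifferentiableOn ℂ G (tube n) ∧
        Set.EqOn (BoxOp^[m] G) (BoxOp^[m] F) (tube n) ∧
        ∃ M' : ℝ, ∀ z ∈ tube n, lor (imP z) ^ k * ‖BoxOp^[k] G z‖ ≤ M') :
    ((n : ℝ) / 2 - 1) / 2 < (k : ℝ) := by
  obtain ⟨d, rfl⟩ : ∃ d, n = d + 2 := ⟨n - 2, by omega⟩
  by_contra! hk
  push_cast at hm hk
  have hm' : d + 1 ≤ 2 * m := by
    have : (d : ℝ) < 2 * m := by linarith
    exact_mod_cast this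
  have hk' : 4 * k ≤ d := by
    have : 4 * (k : ℝ) ≤ d := by linarith
    exact_mod_cast this
  obtain ⟨G, hG, hGF, M, hM⟩ := H (dyadicWave d) differentiableOn_dyadicWave
    (exists_bound_dyadicWave hm')
  have hbound : ∀ a : ℕ, (a : ℝ) + 1 ≤ M ^ 2 * Real.exp (d + 2) := by
    intro a
    have hy : ((1 / 2 ^ a : ℝ) • Pi.single 0 1 : Fin (d + 2) → ℝ) ∈ cone (d + 2) :=
      ⟨by rw [lor_smul_single]; positivity, by simp⟩
    have h := (le_sum_layers hk' a).trans
      (sum_sq_le_of_iterate_boxOp_eqOn (fun _ => freq_mem_cone _ _ _) injective_freq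
        absSummableOnTube_freq hG (by omega) hGF hM hy _)
    have h4 : (0 : ℝ) < (4 ^ a) ^ (2 * k) := by positivity
    rw [lor_smul_single, one_div, inv_pow, div_inv_eq_mul, mul_pow, ← pow_mul _ k 2, mul_comm k 2,
      mul_right_comm, mul_le_mul_iff_left₀ h4, Real.exp_neg, ← div_eq_mul_inv,
      div_le_iff₀ (Real.exp_pos _)] at h
    exact h
  obtain ⟨a, ha⟩ := exists_nat_gt (M ^ 2 * Real.exp (d + 2))
  linarith [hbound a]
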